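/- A finitely generated group Γ is amenable if and only if any two faithful embeddings of Γ into the metric ultraproduct Σ of finite symmetric groups are conjugate by an element of Σ. -/

import Mathlib

open Filter Topology

/-- A finite colored (edge-labeled) directed graph with labels in `L`. -/
structure CGraph (L : Type) where
  n : ℕ
  edges : Finset (Fin n × Fin n × L)

namespace CGraph

variable {L : Type} [DecidableEq L]

/-- Map an edge along a vertex map. -/
def mapEdge {n m : ℕ} (f : Fin n → Fin m) (e : Fin n × Fin n × L) : Fin m × Fin m × L :=
  (f e.1, f e.2.1, e.2.2)

/-- The vertices appearing in an edge set. -/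
def supp {n : ℕ} (E : Finset (Fin n × Fin n × L)) : Finset (Fin n) :=
  E.image (·.1) ∪ E.image (·.2.1)

/-- `f`, `EA` witness an `r`-isomorphism between `A` and `B`: `EA` is a subgraph of `A`
containing at least a `(1 - 1/r)`-fraction of the edges of `A`, whose image under the
(injective-on-`EA`) vertex map `f` is a subgraph of `B` containing at least a
`(1 - 1/r)`-fraction of the edges of `B`. -/
def IsRIsoWitness (r : ℕ) (A B : CGraph L) (f : Fin A.n → Fin B.n)
    (EA : Finset (Fin A.n × Fin A.n × L)) : Prop :=
  EA ⊆ A.edges ∧ Set.InjOn f (supp EA) ∧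
    EA.image (mapEdge f) ⊆ B.edges ∧
    ((1 : ℝ) - 1 / r) * A.edges.card ≤ EA.card ∧
    ((1 : ℝ) - 1 / r) * B.edges.card ≤ EA.card

/-- `A` and `B` are `r`-isomorphic colored graphs. -/
def RIso (r : ℕ) (A B : CGraph L) : Prop :=
  ∃ f EA, IsRIsoWitness r A B f EA

/-- Disjoint union of colored graphs. -/
def disjUnion (A B : CGraph L) : CGraph L :=
  ⟨A.n + B.n,
    (A.edges.image (mapEdge (Fin.castAdd B.n))) ∪ (B.edges.image (mapEdge (Fin.natAdd A.n)))⟩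

/-- Disjoint union of `k` copies of `A`. -/
def nsmul : ℕ → CGraph L → CGraph L
  | 0, _ => ⟨0, ∅⟩
  | k + 1, A => disjUnion A (nsmul k A)

/-- The linear combination `α · T`: disjoint union of `α i` copies of `T i`. -/
def lincomb {m : ℕ} (α : Fin m → ℕ) (T : Fin m → CGraph L) : CGraph L :=
  (List.finRange m).foldr (fun i B => disjUnion (nsmul (α i) (T i)) B) ⟨0, ∅⟩

/-- Restriction of a colored graph to the edges whose color lies in `Z`. -/
def restrict (A : CGraph L) (Z : Finset L) : CGraph L :=
  ⟨A.n, A.edges.filter (fun e => e.2.2 ∈ Z)⟩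

variable {Γ : Type*} [Group Γ]

/-- The ball of radius `r` around `1` in the Cayley graph of `Γ` with respect to the
generators `lab '' S`. -/
def ball (lab : L → Γ) (S : Finset L) (r : ℕ) : Set Γ :=
  {γ | ∃ w : List L, (∀ x ∈ w, x ∈ S) ∧ w.length ≤ r ∧ (w.map lab).prod = γ}

/-- The vertex `p` of `G` has an `r`-neighborhood isomorphic, as a rooted edge-labeled
graph, to the `r`-ball of the Cayley graph of `Γ` with generators `lab '' S`. -/
def GoodVertex (lab : L → Γ) (S : Finset L) (G : CGraph L) (r : ℕ) (p : Fin G.n) : Prop :=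
  ∃ f : Γ → Fin G.n, f 1 = p ∧ Set.InjOn f (ball lab S r) ∧
    ∀ γ ∈ ball lab S r, ∀ δ ∈ ball lab S r, ∀ c : L,
      ((f γ, f δ, c) ∈ G.edges ↔ (c ∈ S ∧ δ = γ * lab c))

/-- `G` is an `r`-approximation of the Cayley graph of `Γ` with generators `lab '' S`. -/
def IsApprox (lab : L → Γ) (S : Finset L) (G : CGraph L) (r : ℕ) : Prop :=
  ((1 : ℝ) - 1 / r) * G.n < {p : Fin G.n | GoodVertex lab S G r p}.ncard

/-- A sofic approximation: for each `r`, eventually all graphs are `r`-approximations. -/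
def SoficApprox (lab : L → Γ) (S : Finset L) (G : ℕ → CGraph L) : Prop :=
  ∀ r : ℕ, ∀ᶠ n in atTop, IsApprox lab S (G n) r

/-- Two vertices are adjacent with respect to an edge set (ignoring colors/orientation). -/
def adjRel {n : ℕ} (E : Finset (Fin n × Fin n × L)) (a b : Fin n) : Prop :=
  ∃ c, (a, b, c) ∈ E ∨ (b, a, c) ∈ E

/-- The connected component of `v` with respect to an edge set. -/
def component {n : ℕ} (E : Finset (Fin n × Fin n × L)) (v : Fin n) : Set (Fin n) :=
  {w | Relation.ReflTransGen (adjRel E) v w}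

/-- A sequence of finite colored graphs is hyperfinite if for every `ε > 0` there is `K`
such that from each `G n` one can erase at most `ε |E(G n)|` edges so that all components
of the remaining graph have at most `K` vertices. -/
def Hyperfinite (G : ℕ → CGraph L) : Prop :=
  ∀ ε : ℝ, 0 < ε → ∃ K : ℕ, ∀ n, ∃ F ⊆ (G n).edges,
    (F.card : ℝ) ≤ ε * (G n).edges.card ∧
    ∀ v, (component ((G n).edges \ F) v).ncard ≤ K

end CGraph

/-- The normalized Hamming rank of a permutation of `Fin n`. -/
noncomputable def rk {n : ℕ} (g : Equiv.Perm (Fin n)) : ℝ :=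
  1 - (Finset.univ.filter fun x => g x = x).card / n

/-- `F` is a Følner sequence of finite subsets of `Γ` with respect to the generating set `S`. -/
def IsFolnerSeq {Γ : Type*} [Group Γ] [DecidableEq Γ] (S : Finset Γ) (F : ℕ → Finset Γ) : Prop :=
  (∀ n, (F n).Nonempty) ∧ ∀ s ∈ S,
    Tendsto (fun n => (((F n).image (· * s) \ F n).card : ℝ) / (F n).card) atTop (𝓝 0)

/-- A sofic representation of `Γ`: a map to the product of finite symmetric groups which is a
homomorphism into the metric ultraproduct `Σ = (∏ Sₙ)/H` and is faithful there
(`rk (φ γ) = 1` for `γ ≠ 1`). -/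
def IsSoficRep (ω : Ultrafilter ℕ) {Γ : Type*} [Group Γ] (N : ℕ → ℕ)
    (φ : Γ → ∀ n : ℕ, Equiv.Perm (Fin (N n))) : Prop :=
  (∀ γ δ : Γ, Tendsto (fun n => rk ((φ γ n * φ δ n)⁻¹ * φ (γ * δ) n)) ω (𝓝 0)) ∧
  (∀ γ : Γ, γ ≠ 1 → Tendsto (fun n => rk (φ γ n)) ω (𝓝 1))

/-- Two sofic representations are conjugate by an element `g` of the metric ultraproduct. -/
def ConjugateReps (ω : Ultrafilter ℕ) {Γ : Type*} [Group Γ] (N : ℕ → ℕ)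
    (φ ψ : Γ → ∀ n : ℕ, Equiv.Perm (Fin (N n))) : Prop :=
  ∃ g : ∀ n : ℕ, Equiv.Perm (Fin (N n)), ∀ γ,
    Tendsto (fun n => rk ((g n * ψ γ n * (g n)⁻¹)⁻¹ * φ γ n)) ω (𝓝 0)

/-- A group is sofic: every finite subset admits arbitrarily good almost-multiplicative,
almost-free approximations by permutations. -/
def IsSofic (G : Type*) [Group G] : Prop :=
  ∀ (F : Finset G) (ε : ℝ), 0 < ε → ∃ (n : ℕ) (f : G → Equiv.Perm (Fin n)), 0 < n ∧
    (∀ g ∈ F, ∀ h ∈ F, rk ((f g * f h)⁻¹ * f (g * h)) ≤ ε) ∧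
    (∀ g ∈ F, g ≠ 1 → 1 - ε ≤ rk (f g))

open Classical in
/-- A group is amenable: it satisfies the Følner condition. -/
def IsAmenable (G : Type*) [Group G] : Prop :=
  ∀ (F : Finset G) (ε : ℝ), 0 < ε → ∃ A : Finset G, A.Nonempty ∧
    ∀ g ∈ F, (((A.image (g * ·)) \ A).card : ℝ) ≤ ε * A.card


/-! ### Negligible families of points -/

open Classical in
/-- A family of predicates on the sets `Fin n` is negligible along `ω` if the proportion of points
satisfying it tends to `0` along `ω`. -/
def Negligible (ω : Ultrafilter ℕ) (bad : ∀ n : ℕ, Fin n → Prop) : Prop :=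
  ∀ η : ℝ, 0 < η → ∀ᶠ n in (ω : Filter ℕ), ((Finset.univ.filter (bad n)).card : ℝ) ≤ η * n

namespace Negligible

variable {ω : Ultrafilter ℕ} {p q : ∀ n : ℕ, Fin n → Prop}

theorem eventually (h : Negligible ω p) [∀ n, DecidablePred (p n)] {η : ℝ} (hη : 0 < η) :
    ∀ᶠ n in (ω : Filter ℕ), ((Finset.univ.filter (p n)).card : ℝ) ≤ η * n := by
  filter_upwards [h η hη] with n hn
  convert hn

theorem of_forall [∀ n, DecidablePred (p n)]
    (h : ∀ η : ℝ, 0 < η → ∀ᶠ n in (ω : Filter ℕ),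
      ((Finset.univ.filter (p n)).card : ℝ) ≤ η * n) : Negligible ω p := by
  intro η hη
  filter_upwards [h η hη] with n hn
  convert hn

theorem mono (h : Negligible ω q) (hpq : ∀ n x, p n x → q n x) : Negligible ω p := by
  classical
  intro η hη
  filter_upwards [h η hη] with n hn
  refine le_trans ?_ hn
  exact_mod_cast Finset.card_le_card fun x hx => by
    simp only [Finset.mem_filter, Finset.mem_univ, true_and] at hx ⊢
    exact hpq n x hx

theorem or (hp : Negligible ω p) (hq : Negligible ω q) :
    Negligible ω (fun n x => p n x ∨ q n x) := by
  classical
  intro η hη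
  filter_upwards [hp (η / 2) (by positivity), hq (η / 2) (by positivity)] with n h1 h2
  have h : ((Finset.univ.filter fun x => p n x ∨ q n x).card : ℝ) ≤
      (Finset.univ.filter (p n)).card + (Finset.univ.filter (q n)).card := by
    rw [Finset.filter_or]
    exact_mod_cast Finset.card_union_le _ _
  refine le_trans (le_of_eq ?_) (h.trans (by linarith))
  congr!

theorem false (ω : Ultrafilter ℕ) : Negligible ω (fun _ _ => False) := by
  classical
  intro η hη
  filter_upwards with n
  simp only [Finset.filter_false, Finset.card_empty, Nat.cast_zero]
  positivity

theorem exists_mem {ι : Type*} (T : Finset ι) {r : ι → ∀ n : ℕ, Fin n → Prop}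
    (h : ∀ i ∈ T, Negligible ω (r i)) : Negligible ω (fun n x => ∃ i ∈ T, r i n x) := by
  classical
  induction T using Finset.induction_on with
  | empty => exact (Negligible.false ω).mono (by simp)
  | insert i T _ ih =>
    refine ((h i (by simp)).or (ih fun j hj => h j (by simp [hj]))).mono ?_
    intro n x hx
    simpa using hx

theorem comp_perm (h : Negligible ω p) (σ : ∀ n, Equiv.Perm (Fin n)) :
    Negligible ω (fun n x => p n (σ n x)) := by
  classical
  intro η hη
  filter_upwards [h η hη] with n hn
  refine le_trans ?_ hn
  exact_mod_cast Finset.card_le_card_of_injOn (σ n) (fun x hx => by simpa using hx)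
    (σ n).injective.injOn

theorem of_comp_perm (σ : ∀ n, Equiv.Perm (Fin n))
    (h : Negligible ω (fun n x => p n (σ n x))) : Negligible ω p :=
  (h.comp_perm fun n => (σ n)⁻¹).mono (by simp)

end Negligible

theorem rk_eq_card_ne_div {n : ℕ} (hn : 0 < n) (g : Equiv.Perm (Fin n)) :
    rk g = (Finset.univ.filter fun x => g x ≠ x).card / n := by
  have h := Finset.card_filter_add_card_filter_not (s := (Finset.univ : Finset (Fin n)))
    (fun x => g x = x)
  rw [Finset.card_univ, Fintype.card_fin] at h
  have h' : ((Finset.univ.filter fun x => g x = x).card : ℝ)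
      + (Finset.univ.filter fun x => g x ≠ x).card = n := by exact_mod_cast h
  have : (n : ℝ) ≠ 0 := by positivity
  rw [rk, eq_div_iff this, sub_mul, div_mul_cancel₀ _ this]
  linarith

theorem tendsto_zero_iff_negligible {ω : Ultrafilter ℕ} (hω : (ω : Filter ℕ) ≤ cofinite)
    (p : ∀ n : ℕ, Fin n → Prop) [∀ n, DecidablePred (p n)] :
    Tendsto (fun n => ((Finset.univ.filter (p n)).card : ℝ) / n) ω (𝓝 0) ↔ Negligible ω p := by
  have hpos : ∀ᶠ n in (ω : Filter ℕ), 0 < n := by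
    apply hω
    rw [Nat.cofinite_eq_atTop]
    exact eventually_gt_atTop 0
  constructor
  · intro h
    refine Negligible.of_forall fun η hη => ?_
    filter_upwards [h.eventually (gt_mem_nhds hη), hpos] with n h1 h2
    have : (0 : ℝ) < n := by exact_mod_cast h2
    rw [div_lt_iff₀ this] at h1
    exact h1.le
  · intro h
    rw [Metric.tendsto_nhds]
    intro η hη
    filter_upwards [h.eventually (half_pos hη), hpos] with n h1 h2
    have h3 : (0 : ℝ) < n := by exact_mod_cast h2
    rw [Real.dist_eq, sub_zero, abs_of_nonneg (by positivity), div_lt_iff₀ h3]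
    nlinarith

theorem tendsto_rk_inv_mul_iff {ω : Ultrafilter ℕ} (hω : (ω : Filter ℕ) ≤ cofinite)
    (σ τ : ∀ n : ℕ, Equiv.Perm (Fin n)) :
    Tendsto (fun n => rk ((σ n)⁻¹ * τ n)) ω (𝓝 0) ↔
      Negligible ω (fun n x => τ n x ≠ σ n x) := by
  rw [← tendsto_zero_iff_negligible hω]
  apply tendsto_congr'
  have hpos : ∀ᶠ n in (ω : Filter ℕ), 0 < n := by
    apply hω
    rw [Nat.cofinite_eq_atTop]
    exact eventually_gt_atTop 0
  filter_upwards [hpos] with n hn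
  rw [rk_eq_card_ne_div hn]
  simp only [Equiv.Perm.mul_apply, ne_eq, Equiv.Perm.inv_eq_iff_eq]

theorem tendsto_rk_one_iff {ω : Ultrafilter ℕ} (hω : (ω : Filter ℕ) ≤ cofinite)
    (σ : ∀ n : ℕ, Equiv.Perm (Fin n)) :
    Tendsto (fun n => rk (σ n)) ω (𝓝 1) ↔ Negligible ω (fun n x => σ n x = x) := by
  rw [← tendsto_zero_iff_negligible hω]
  constructor
  · intro h
    simpa [rk] using (tendsto_const_nhds (x := (1 : ℝ))).sub h
  · intro h
    simpa [rk] using (tendsto_const_nhds (x := (1 : ℝ))).sub h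

theorem isSoficRep_iff {ω : Ultrafilter ℕ} (hω : (ω : Filter ℕ) ≤ cofinite)
    {Γ : Type*} [Group Γ] (φ : Γ → ∀ n : ℕ, Equiv.Perm (Fin n)) :
    IsSoficRep ω (fun n => n) φ ↔
      (∀ γ δ : Γ, Negligible ω (fun n x => φ (γ * δ) n x ≠ φ γ n (φ δ n x))) ∧
      (∀ γ : Γ, γ ≠ 1 → Negligible ω (fun n x => φ γ n x = x)) := by
  unfold IsSoficRep
  refine and_congr (forall₂_congr fun γ δ => ?_) (forall₂_congr fun γ _ => ?_)
  · exact tendsto_rk_inv_mul_iff hω (fun n => φ γ n * φ δ n) (φ (γ * δ))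
  · exact tendsto_rk_one_iff hω (φ γ)

theorem conjugateReps_iff {ω : Ultrafilter ℕ} (hω : (ω : Filter ℕ) ≤ cofinite)
    {Γ : Type*} [Group Γ] (φ ψ : Γ → ∀ n : ℕ, Equiv.Perm (Fin n)) :
    ConjugateReps ω (fun n => n) φ ψ ↔ ∃ g : ∀ n : ℕ, Equiv.Perm (Fin n), ∀ γ,
      Negligible ω (fun n x => φ γ n (g n x) ≠ g n (ψ γ n x)) := by
  unfold ConjugateReps
  refine exists_congr fun g => forall_congr' fun γ => ?_
  refine (tendsto_rk_inv_mul_iff hω (fun n => g n * ψ γ n * (g n)⁻¹) (φ γ)).trans ⟨fun h => ?_,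
    fun h => ?_⟩
  · exact (h.comp_perm g).mono (by simp)
  · exact Negligible.of_comp_perm g (h.mono (by simp))

namespace IsSoficRep

variable {ω : Ultrafilter ℕ} {Γ : Type*} [Group Γ] {φ : Γ → ∀ n : ℕ, Equiv.Perm (Fin n)}

theorem negligible_mul (hω : (ω : Filter ℕ) ≤ cofinite) (h : IsSoficRep ω (fun n => n) φ)
    (γ δ : Γ) : Negligible ω (fun n x => φ (γ * δ) n x ≠ φ γ n (φ δ n x)) :=
  ((isSoficRep_iff hω φ).1 h).1 γ δ

theorem negligible_one (hω : (ω : Filter ℕ) ≤ cofinite) (h : IsSoficRep ω (fun n => n) φ) :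
    Negligible ω (fun n x => φ 1 n x ≠ x) := by
  refine (h.negligible_mul hω 1 1).mono fun n x hx h' => hx ?_
  rw [mul_one] at h'
  exact ((φ 1 n).injective h').symm

theorem negligible_inv (hω : (ω : Filter ℕ) ≤ cofinite) (h : IsSoficRep ω (fun n => n) φ)
    (γ : Γ) : Negligible ω (fun n x => φ γ⁻¹ n (φ γ n x) ≠ x) := by
  refine ((h.negligible_mul hω γ⁻¹ γ).or (h.negligible_one hω)).mono fun n x hx => ?_
  by_contra! h'
  rw [inv_mul_cancel] at h'
  exact hx (h'.1.symm.trans h'.2)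

theorem negligible_eq (hω : (ω : Filter ℕ) ≤ cofinite) (h : IsSoficRep ω (fun n => n) φ)
    {γ δ : Γ} (hne : γ ≠ δ) : Negligible ω (fun n x => φ γ n x = φ δ n x) := by
  have h1 := ((isSoficRep_iff hω φ).1 h).2 (γ * δ⁻¹) (by rwa [ne_eq, mul_inv_eq_one])
  refine ((h.negligible_mul hω (γ * δ⁻¹) δ).or (h1.comp_perm (φ δ))).mono fun n x hx => ?_
  by_contra! h'
  rw [inv_mul_cancel_right] at h'
  exact h'.2 (h'.1.symm.trans hx)

/-- Outside a negligible set of points, the orbit map is injective on a given finite set. -/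
theorem negligible_not_injOn (hω : (ω : Filter ℕ) ≤ cofinite)
    (h : IsSoficRep ω (fun n => n) φ) (F : Finset Γ) :
    Negligible ω (fun n x => ¬ Set.InjOn (fun γ => φ γ n x) F) := by
  have : Negligible ω (fun n x => ∃ γ ∈ F, ∃ δ ∈ F, γ ≠ δ ∧ φ γ n x = φ δ n x) := by
    refine Negligible.exists_mem F fun γ _ => Negligible.exists_mem F fun δ _ => ?_
    by_cases hγ : γ = δ
    · exact (Negligible.false ω).mono (by simp [hγ])
    · exact (h.negligible_eq hω hγ).mono (by simp)
  refine this.mono fun n x hx => ?_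
  by_contra! h'
  exact hx fun γ hγ δ hδ he => by_contra fun hne => h' γ hγ δ hδ hne he

/-- Outside a negligible set of points, multiplicativity holds for given finite sets. -/
theorem negligible_exists_mul (hω : (ω : Filter ℕ) ≤ cofinite)
    (h : IsSoficRep ω (fun n => n) φ) (E F : Finset Γ) :
    Negligible ω (fun n x => ∃ γ ∈ E, ∃ δ ∈ F, φ (γ * δ) n x ≠ φ γ n (φ δ n x)) :=
  Negligible.exists_mem E fun γ _ => Negligible.exists_mem F fun δ _ => h.negligible_mul hω γ δ

end IsSoficRep

/-- A slowly growing choice of parameter along an ultrafilter. -/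
theorem exists_tendsto_of_eventually {ω : Ultrafilter ℕ} (hω : (ω : Filter ℕ) ≤ cofinite)
    {P : ℕ → ℕ → Prop} (h : ∀ j, ∀ᶠ n in (ω : Filter ℕ), P j n) :
    ∃ J : ℕ → ℕ, Tendsto J ω atTop ∧ ∀ᶠ n in (ω : Filter ℕ), P (J n) n := by
  classical
  refine ⟨fun n => Nat.findGreatest (fun j => P j n) n, ?_, ?_⟩
  · rw [tendsto_atTop]
    intro j
    have hj : ∀ᶠ n in (ω : Filter ℕ), j ≤ n := by
      apply hω
      rw [Nat.cofinite_eq_atTop]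
      exact eventually_ge_atTop j
    filter_upwards [h j, hj] with n h1 h2
    exact Nat.le_findGreatest h2 h1
  · filter_upwards [h 0] with n hn
    exact Nat.findGreatest_spec (P := fun j => P j n) (Nat.zero_le n) hn

/-! ### Greedy simultaneous tilings -/

/-- `P` is a partial matching between two actions `a` and `b` on `V`, contained in `A × B`, whose
projections almost fill `A` and `B`, and which is almost invariant under the elements of `E`. -/
structure IsAlmostMatching {Γ V : Type*} [DecidableEq V] (θ : ℝ) (E : Finset Γ)
    (a b : Γ → Equiv.Perm V) (P : Finset (V × V)) (A B : Finset V) : Prop where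
  injOn_fst : Set.InjOn Prod.fst (P : Set (V × V))
  injOn_snd : Set.InjOn Prod.snd (P : Set (V × V))
  fst_mem : ∀ p ∈ P, p.1 ∈ A
  snd_mem : ∀ p ∈ P, p.2 ∈ B
  card_fst : (1 - 2 * θ) * A.card ≤ P.card
  card_snd : (1 - 2 * θ) * B.card ≤ P.card
  card_moved : ∀ γ ∈ E, ((P.filter fun p => (a γ p.1, b γ p.2) ∉ P).card : ℝ) ≤ 6 * θ * P.card

section Tiling

variable {Γ V : Type*} [Group Γ] [DecidableEq Γ] [DecidableEq V]

/-- Adding a tile `F • x` to a set increases its boundary by at most the boundary of `F`. -/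
theorem card_boundary_union_tile_le {a : Γ → Equiv.Perm V} {A : Finset V} {F : Finset Γ} {x : V}
    {γ : Γ} (hmul : ∀ f ∈ F, a (γ * f) x = a γ (a f x)) :
    ((A ∪ F.image fun f => a f x).filter fun v => a γ v ∉ A ∪ F.image fun f => a f x).card ≤
      (A.filter fun v => a γ v ∉ A).card + (F.filter fun f => γ * f ∉ F).card := by
  have hsub : ((A ∪ F.image fun f => a f x).filter
      fun v => a γ v ∉ A ∪ F.image fun f => a f x) ⊆
      (A.filter fun v => a γ v ∉ A) ∪ (F.filter fun f => γ * f ∉ F).image fun f => a f x := by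
    intro v hv
    simp only [Finset.mem_filter, Finset.mem_union, Finset.mem_image, not_or, not_exists,
      not_and] at hv ⊢
    obtain ⟨hv | ⟨f, hf, rfl⟩, h1, h2⟩ := hv
    · exact Or.inl ⟨hv, h1⟩
    · exact Or.inr ⟨f, ⟨hf, fun h => h2 _ h (hmul f hf)⟩, rfl⟩
  exact (Finset.card_le_card hsub).trans ((Finset.card_union_le _ _).trans
    (Nat.add_le_add_left Finset.card_image_le _))

/-- A tile almost disjoint from the part already matched, on both sides, can be added. -/
theorem IsAlmostMatching.exists_add_tile {θ ε : ℝ} (hθ : 0 < θ) (hθ' : θ ≤ 1 / 4) (hε : ε ≤ θ)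
    {E₀ E : Finset Γ} (hE : E₀ ⊆ E) {a b : Γ → Equiv.Perm V} {P : Finset (V × V)}
    {A B : Finset V} (h : IsAlmostMatching θ E₀ a b P A B) {F : Finset Γ}
    (hF : ∀ γ ∈ E, ((F.filter fun f => γ * f ∉ F).card : ℝ) ≤ ε * F.card) {x y : V}
    (hx : Set.InjOn (fun f => a f x) F) (hy : Set.InjOn (fun f => b f y) F)
    (hmx : ∀ γ ∈ E, ∀ f ∈ F, a (γ * f) x = a γ (a f x))
    (hmy : ∀ γ ∈ E, ∀ f ∈ F, b (γ * f) y = b γ (b f y))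
    (hxA : ((F.filter fun f => a f x ∈ A).card : ℝ) ≤ θ * F.card)
    (hyB : ((F.filter fun f => b f y ∈ B).card : ℝ) ≤ θ * F.card) :
    ∃ P' A' B', IsAlmostMatching θ E₀ a b P' A' B' ∧ A ⊆ A' ∧ B ⊆ B' ∧
      (P.card : ℝ) + F.card / 2 ≤ P'.card ∧
      (∀ γ ∈ E, ((A'.filter fun v => a γ v ∉ A').card : ℝ) ≤
        (A.filter fun v => a γ v ∉ A).card + ε * F.card) ∧
      (∀ γ ∈ E, ((B'.filter fun v => b γ v ∉ B').card : ℝ) ≤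
        (B.filter fun v => b γ v ∉ B).card + ε * F.card) := by
  set F' := F.filter fun f => a f x ∉ A ∧ b f y ∉ B with hF'
  set T := F'.image fun f => (a f x, b f y) with hT
  have hF'F : F' ⊆ F := Finset.filter_subset _ _
  have hTcard : T.card = F'.card := Finset.card_image_of_injOn fun f hf f' hf' he =>
    hx (hF'F hf) (hF'F hf') (congrArg Prod.fst he)
  have hcompl : ((F \ F').card : ℝ) ≤ 2 * θ * F.card := by
    have : F \ F' ⊆ (F.filter fun f => a f x ∈ A) ∪ F.filter fun f => b f y ∈ B := by
      intro f hf
      simp only [hF', Finset.mem_sdiff, Finset.mem_filter, Finset.mem_union] at hf ⊢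
      tauto
    have h2 : ((F \ F').card : ℝ) ≤ (F.filter fun f => a f x ∈ A).card +
        (F.filter fun f => b f y ∈ B).card := by
      exact_mod_cast (Finset.card_le_card this).trans (Finset.card_union_le _ _)
    linarith
  have hF'card : (1 - 2 * θ) * F.card ≤ F'.card := by
    have : ((F \ F').card : ℝ) + F'.card = F.card := by
      exact_mod_cast Finset.card_sdiff_add_card_eq_card hF'F
    linarith
  have hhalf : (F.card : ℝ) / 2 ≤ F'.card := by
    have : (0 : ℝ) ≤ F.card := by positivity
    nlinarith
  have hdisj : Disjoint P T := by
    rw [Finset.disjoint_left]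
    intro p hp hpT
    obtain ⟨f, hf, rfl⟩ := Finset.mem_image.1 hpT
    exact (Finset.mem_filter.1 hf).2.1 (h.fst_mem _ hp)
  have hP'card : ((P ∪ T).card : ℝ) = P.card + F'.card := by
    rw [Finset.card_union_of_disjoint hdisj, hTcard]
    push_cast
    ring
  have key : ∀ (c : Γ → Equiv.Perm V) (z : V) (C : Finset V),
      (1 - 2 * θ) * C.card ≤ P.card →
      (1 - 2 * θ) * ((C ∪ F.image fun f => c f z).card : ℝ) ≤ (P ∪ T).card := by
    intro c z C hC
    have h1 : ((C ∪ F.image fun f => c f z).card : ℝ) ≤ C.card + F.card := by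
      exact_mod_cast (Finset.card_union_le _ _).trans (Nat.add_le_add_left Finset.card_image_le _)
    rw [hP'card]
    nlinarith
  refine ⟨P ∪ T, A ∪ F.image fun f => a f x, B ∪ F.image fun f => b f y, ⟨?_, ?_, ?_, ?_,
    key a x A h.card_fst, key b y B h.card_snd, ?_⟩, Finset.subset_union_left,
    Finset.subset_union_left, ?_, ?_, ?_⟩
  · rw [Finset.coe_union, Set.injOn_union (by exact_mod_cast hdisj)]
    refine ⟨h.injOn_fst, ?_, ?_⟩
    · intro p hp q hq hpq
      obtain ⟨f, hf, rfl⟩ := Finset.mem_image.1 (Finset.mem_coe.1 hp)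
      obtain ⟨f', hf', rfl⟩ := Finset.mem_image.1 (Finset.mem_coe.1 hq)
      rw [hx (hF'F hf) (hF'F hf') hpq]
    · intro p hp q hq hpq
      obtain ⟨f, hf, rfl⟩ := Finset.mem_image.1 (Finset.mem_coe.1 hq)
      replace hpq : p.1 = a f x := hpq
      exact (Finset.mem_filter.1 hf).2.1 (hpq ▸ h.fst_mem _ hp)
  · rw [Finset.coe_union, Set.injOn_union (by exact_mod_cast hdisj)]
    refine ⟨h.injOn_snd, ?_, ?_⟩
    · intro p hp q hq hpq
      obtain ⟨f, hf, rfl⟩ := Finset.mem_image.1 (Finset.mem_coe.1 hp)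
      obtain ⟨f', hf', rfl⟩ := Finset.mem_image.1 (Finset.mem_coe.1 hq)
      rw [hy (hF'F hf) (hF'F hf') hpq]
    · intro p hp q hq hpq
      obtain ⟨f, hf, rfl⟩ := Finset.mem_image.1 (Finset.mem_coe.1 hq)
      replace hpq : p.2 = b f y := hpq
      exact (Finset.mem_filter.1 hf).2.2 (hpq ▸ h.snd_mem _ hp)
  · intro p hp
    rcases Finset.mem_union.1 hp with hp | hp
    · exact Finset.mem_union_left _ (h.fst_mem _ hp)
    · obtain ⟨f, hf, rfl⟩ := Finset.mem_image.1 hp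
      exact Finset.mem_union_right _ (Finset.mem_image_of_mem (fun f => a f x) (hF'F hf))
  · intro p hp
    rcases Finset.mem_union.1 hp with hp | hp
    · exact Finset.mem_union_left _ (h.snd_mem _ hp)
    · obtain ⟨f, hf, rfl⟩ := Finset.mem_image.1 hp
      exact Finset.mem_union_right _ (Finset.mem_image_of_mem (fun f => b f y) (hF'F hf))
  · intro γ hγ
    have hsub : ((P ∪ T).filter fun p => (a γ p.1, b γ p.2) ∉ P ∪ T) ⊆
        (P.filter fun p => (a γ p.1, b γ p.2) ∉ P) ∪
          ((F.filter fun f => γ * f ∉ F).image (fun f => (a f x, b f y)) ∪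
            (F \ F').image (fun f => (a (γ⁻¹ * f) x, b (γ⁻¹ * f) y))) := by
      intro p hp
      rw [Finset.mem_filter] at hp
      obtain ⟨hp, hnot⟩ := hp
      rcases Finset.mem_union.1 hp with hp | hp
      · refine Finset.mem_union_left _ (Finset.mem_filter.2 ⟨hp, fun h' => hnot ?_⟩)
        exact Finset.mem_union_left _ h'
      · obtain ⟨f, hf, rfl⟩ := Finset.mem_image.1 hp
        refine Finset.mem_union_right _ ?_
        by_cases hγf : γ * f ∈ F
        · refine Finset.mem_union_right _ (Finset.mem_image.2 ⟨γ * f, ?_, by simp⟩)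
          refine Finset.mem_sdiff.2 ⟨hγf, fun h' => hnot (Finset.mem_union_right _ ?_)⟩
          refine Finset.mem_image.2 ⟨γ * f, h', ?_⟩
          rw [hmx γ (hE hγ) f (hF'F hf), hmy γ (hE hγ) f (hF'F hf)]
        · exact Finset.mem_union_left _ (Finset.mem_image.2
            ⟨f, Finset.mem_filter.2 ⟨hF'F hf, hγf⟩, rfl⟩)
    have hcard : (((P ∪ T).filter fun p => (a γ p.1, b γ p.2) ∉ P ∪ T).card : ℝ) ≤
        (P.filter fun p => (a γ p.1, b γ p.2) ∉ P).card +
          ((F.filter fun f => γ * f ∉ F).card + (F \ F').card) := by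
      exact_mod_cast (Finset.card_le_card hsub).trans ((Finset.card_union_le _ _).trans
        (Nat.add_le_add_left ((Finset.card_union_le _ _).trans
          (Nat.add_le_add Finset.card_image_le Finset.card_image_le)) _))
    have h1 := h.card_moved γ hγ
    have h2 := hF γ (hE hγ)
    have h3 : ε * F.card ≤ θ * F.card := by gcongr
    have h4 : θ * (F.card / 2) ≤ θ * F'.card := by gcongr
    rw [hP'card]
    linarith
  · rw [hP'card]
    linarith
  · intro γ hγ
    have h1 : ((((A ∪ F.image fun f => a f x).filter
        fun v => a γ v ∉ A ∪ F.image fun f => a f x).card : ℕ) : ℝ) ≤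
        (A.filter fun v => a γ v ∉ A).card + (F.filter fun f => γ * f ∉ F).card := by
      exact_mod_cast card_boundary_union_tile_le (hmx γ hγ)
    linarith [hF γ hγ]
  · intro γ hγ
    have h1 : ((((B ∪ F.image fun f => b f y).filter
        fun v => b γ v ∉ B ∪ F.image fun f => b f y).card : ℕ) : ℝ) ≤
        (B.filter fun v => b γ v ∉ B).card + (F.filter fun f => γ * f ∉ F).card := by
      exact_mod_cast card_boundary_union_tile_le (hmy γ hγ)
    linarith [hF γ hγ]

/-- Adding tiles of shape `F` until it is no longer possible on one of the two sides. -/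
theorem IsAlmostMatching.exists_maximal [Fintype V] {θ ε β : ℝ} (hθ : 0 < θ) (hθ' : θ ≤ 1 / 4)
    (hε : 0 ≤ ε) (hεθ : ε ≤ θ) {E₀ E : Finset Γ} (hE : E₀ ⊆ E) {a b : Γ → Equiv.Perm V}
    {P : Finset (V × V)} {A B : Finset V} (h : IsAlmostMatching θ E₀ a b P A B)
    (hA : ∀ γ ∈ E, ((A.filter fun v => a γ v ∉ A).card : ℝ) ≤ β)
    (hB : ∀ γ ∈ E, ((B.filter fun v => b γ v ∉ B).card : ℝ) ≤ β)
    {F : Finset Γ} (hFne : F.Nonempty)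
    (hF : ∀ γ ∈ E, ((F.filter fun f => γ * f ∉ F).card : ℝ) ≤ ε * F.card) {X Y : Finset V}
    (hX : ∀ x ∈ X, Set.InjOn (fun f => a f x) F) (hY : ∀ y ∈ Y, Set.InjOn (fun f => b f y) F)
    (hmX : ∀ x ∈ X, ∀ γ ∈ E, ∀ f ∈ F, a (γ * f) x = a γ (a f x))
    (hmY : ∀ y ∈ Y, ∀ γ ∈ E, ∀ f ∈ F, b (γ * f) y = b γ (b f y)) :
    ∃ P' A' B', IsAlmostMatching θ E₀ a b P' A' B' ∧ A ⊆ A' ∧ B ⊆ B' ∧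
      (∀ γ ∈ E, ((A'.filter fun v => a γ v ∉ A').card : ℝ) ≤ β + 2 * ε * Fintype.card V) ∧
      (∀ γ ∈ E, ((B'.filter fun v => b γ v ∉ B').card : ℝ) ≤ β + 2 * ε * Fintype.card V) ∧
      ((∀ x ∈ X, θ * F.card ≤ (F.filter fun f => a f x ∈ A').card) ∨
        (∀ y ∈ Y, θ * F.card ≤ (F.filter fun f => b f y ∈ B').card)) := by
  classical
  let good : Finset (V × V) × Finset V × Finset V → Prop := fun S =>
    IsAlmostMatching θ E₀ a b S.1 S.2.1 S.2.2 ∧ A ⊆ S.2.1 ∧ B ⊆ S.2.2 ∧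
      (∀ γ ∈ E, ((S.2.1.filter fun v => a γ v ∉ S.2.1).card : ℝ) ≤ β + 2 * ε * S.1.card) ∧
      (∀ γ ∈ E, ((S.2.2.filter fun v => b γ v ∉ S.2.2).card : ℝ) ≤ β + 2 * ε * S.1.card)
  have hne : (Finset.univ.filter good).Nonempty := by
    refine ⟨(P, A, B), Finset.mem_filter.2 ⟨Finset.mem_univ _, h, subset_rfl, subset_rfl, ?_, ?_⟩⟩
    · exact fun γ hγ => (hA γ hγ).trans (le_add_of_nonneg_right (by positivity))
    · exact fun γ hγ => (hB γ hγ).trans (le_add_of_nonneg_right (by positivity))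
  obtain ⟨⟨P', A', B'⟩, hmem, hmax⟩ := Finset.exists_max_image _ (fun S => S.1.card) hne
  obtain ⟨h', hAA', hBB', hA', hB'⟩ := (Finset.mem_filter.1 hmem).2
  dsimp only at h' hAA' hBB' hA' hB'
  have hP' : (P'.card : ℝ) ≤ Fintype.card V := by
    rw [← Finset.card_image_of_injOn h'.injOn_fst]
    exact_mod_cast Finset.card_le_univ _
  have hcard : β + 2 * ε * P'.card ≤ β + 2 * ε * Fintype.card V := by gcongr
  refine ⟨P', A', B', h', hAA', hBB', fun γ hγ => (hA' γ hγ).trans hcard,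
    fun γ hγ => (hB' γ hγ).trans hcard, ?_⟩
  by_contra! hcon
  obtain ⟨⟨x, hx, hxA⟩, y, hy, hyB⟩ := hcon
  obtain ⟨P'', A'', B'', h'', hAA, hBB, hPP, hbA, hbB⟩ :=
    h'.exists_add_tile hθ hθ' hεθ hE hF (hX x hx) (hY y hy) (hmX x hx) (hmY y hy) hxA.le hyB.le
  have hFpos : (0 : ℝ) < F.card := by exact_mod_cast hFne.card_pos
  have hlt : P'.card < P''.card := by
    have : (P'.card : ℝ) < P''.card := by linarith
    exact_mod_cast this
  refine absurd (hmax (P'', A'', B'') (Finset.mem_filter.2 ⟨Finset.mem_univ _, h'',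
    hAA'.trans hAA, hBB'.trans hBB, ?_, ?_⟩)) (not_le.2 hlt)
  · intro γ hγ
    have := mul_le_mul_of_nonneg_left hPP hε
    dsimp only
    linarith [hbA γ hγ, hA' γ hγ]
  · intro γ hγ
    have := mul_le_mul_of_nonneg_left hPP hε
    dsimp only
    linarith [hbB γ hγ, hB' γ hγ]

end Tiling

/-- If every tile of shape `F` meets `A'` substantially, then `A'` covers a definite proportion of
the complement of any almost invariant subset `A`. -/
theorem le_card_sdiff_of_tiles_meet {Γ V : Type*} [Group Γ] [Fintype V] [DecidableEq V]
    {θ β : ℝ} (hθ : 0 ≤ θ) {a : Γ → Equiv.Perm V}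
    {A A' X : Finset V} (hAA' : A ⊆ A') {F : Finset Γ} {f₀ : Γ} (hf₀ : f₀ ∈ F)
    (hbd : ∀ f ∈ F, ((A.filter fun v => a (f₀ * f⁻¹) v ∉ A).card : ℝ) ≤ β)
    (hX : ∀ x ∈ X, ∀ f ∈ F, a f₀ x = a (f₀ * f⁻¹) (a f x))
    (hmeet : ∀ x ∈ X, θ * F.card ≤ (F.filter fun f => a f x ∈ A').card) :
    (Fintype.card V - A'.card : ℝ) ≤
      (1 - θ) * (Fintype.card V - A.card) + θ * (Xᶜ.card + F.card * β) := by
  set X₀ := X.filter fun x => ∀ f ∈ F, a f x ∉ A with hX₀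
  have hcover : (Finset.univ.filter fun x => a f₀ x ∉ A) ⊆ X₀ ∪ (Xᶜ ∪
      F.biUnion fun f => Finset.univ.filter fun x => a f x ∈ A ∧ a (f₀ * f⁻¹) (a f x) ∉ A) := by
    intro x hx
    simp only [Finset.mem_filter, Finset.mem_univ, true_and] at hx
    by_cases hxX : x ∈ X
    · by_cases hall : ∀ f ∈ F, a f x ∉ A
      · exact Finset.mem_union_left _ (Finset.mem_filter.2 ⟨hxX, hall⟩)
      · push Not at hall
        obtain ⟨f, hf, hfA⟩ := hall
        refine Finset.mem_union_right _ (Finset.mem_union_right _ (Finset.mem_biUnion.2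
          ⟨f, hf, Finset.mem_filter.2 ⟨Finset.mem_univ _, hfA, ?_⟩⟩))
        rwa [← hX x hxX f hf]
    · exact Finset.mem_union_right _ (Finset.mem_union_left _ (Finset.mem_compl.2 hxX))
  have hleft : ((Finset.univ.filter fun x => a f₀ x ∉ A).card : ℝ) = Fintype.card V - A.card := by
    have : (Finset.univ.filter fun x => a f₀ x ∉ A).card = Aᶜ.card := by
      refine Finset.card_bij (fun x _ => a f₀ x) (by simp) (by simp) fun v hv => ?_
      exact ⟨(a f₀).symm v, by simpa using hv, by simp⟩
    rw [this, Finset.card_compl, Nat.cast_sub (Finset.card_le_univ _)]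
  have hbi : ((F.biUnion fun f => Finset.univ.filter fun x =>
      a f x ∈ A ∧ a (f₀ * f⁻¹) (a f x) ∉ A).card : ℝ) ≤ F.card * β := by
    refine le_trans (Nat.cast_le.2 Finset.card_biUnion_le) ?_
    push_cast
    rw [← nsmul_eq_mul]
    refine Finset.sum_le_card_nsmul _ _ _ fun f hf => le_trans ?_ (hbd f hf)
    exact_mod_cast Finset.card_le_card_of_injOn (a f) (fun x hx => by simpa using hx)
      (a f).injective.injOn
  have hsum : (Fintype.card V - A.card : ℝ) ≤ X₀.card + (Xᶜ.card + F.card * β) := by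
    rw [← hleft]
    have : ((Finset.univ.filter fun x => a f₀ x ∉ A).card : ℝ) ≤ X₀.card + (Xᶜ.card +
        (F.biUnion fun f => Finset.univ.filter fun x =>
          a f x ∈ A ∧ a (f₀ * f⁻¹) (a f x) ∉ A).card) := by
      exact_mod_cast (Finset.card_le_card hcover).trans ((Finset.card_union_le _ _).trans
        (Nat.add_le_add_left (Finset.card_union_le _ _) _))
    linarith
  have hdouble : ∑ x : V, (F.filter fun f => a f x ∈ A' \ A).card = F.card * (A' \ A).card := by
    have := Finset.sum_card_bipartiteAbove_eq_sum_card_bipartiteBelow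
      (fun (x : V) (f : Γ) => a f x ∈ A' \ A) (s := Finset.univ) (t := F)
    unfold Finset.bipartiteAbove Finset.bipartiteBelow at this
    rw [this, ← smul_eq_mul]
    refine Finset.sum_eq_card_nsmul fun f _ => ?_
    refine Finset.card_bij (fun x _ => a f x) (by simp) (by simp) fun v hv => ?_
    exact ⟨(a f).symm v, by simpa using hv, by simp⟩
  have hlow : X₀.card * (θ * F.card) ≤ (F.card : ℝ) * (A' \ A).card := by
    rw [← Nat.cast_mul, ← hdouble, ← nsmul_eq_mul]
    push_cast
    refine le_trans (Finset.card_nsmul_le_sum X₀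
      (fun x => ((F.filter fun f => a f x ∈ A' \ A).card : ℝ)) _ fun x hx => ?_)
      (Finset.sum_le_sum_of_subset_of_nonneg (Finset.subset_univ _) fun _ _ _ => by positivity)
    rw [hX₀, Finset.mem_filter] at hx
    refine (hmeet x hx.1).trans ?_
    exact_mod_cast Finset.card_le_card fun f hf => by
      rw [Finset.mem_filter] at hf ⊢
      exact ⟨hf.1, Finset.mem_sdiff.2 ⟨hf.2, hx.2 f hf.1⟩⟩
  have hFpos : (0 : ℝ) < F.card := by exact_mod_cast Finset.card_pos.2 ⟨f₀, hf₀⟩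
  have hlow' : θ * X₀.card ≤ (A' \ A).card := by
    refine le_of_mul_le_mul_left ?_ hFpos
    linarith
  have hdiff : ((A' \ A).card : ℝ) + A.card = A'.card := by
    exact_mod_cast Finset.card_sdiff_add_card_eq_card hAA'
  have := mul_le_mul_of_nonneg_left hsum hθ
  linarith

/-- An almost matching extends to a permutation that almost intertwines the two actions. -/
theorem IsAlmostMatching.exists_perm {Γ V : Type*} [Fintype V] [DecidableEq V] {θ : ℝ}
    {E : Finset Γ} {a b : Γ → Equiv.Perm V} {P : Finset (V × V)} {A B : Finset V}
    (h : IsAlmostMatching θ E a b P A B) :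
    ∃ g : Equiv.Perm V, ∀ γ ∈ E,
      ((Finset.univ.filter fun v => a γ (g v) ≠ g (b γ v)).card : ℝ) ≤
        (Fintype.card V - P.card) + 6 * θ * P.card := by
  rcases isEmpty_or_nonempty V with hV | hV
  · refine ⟨1, fun γ _ => ?_⟩
    have hP : P = ∅ := Finset.eq_empty_of_isEmpty P
    simp [hP]
  have hinv : ∀ p ∈ P, Function.invFunOn Prod.snd (P : Set (V × V)) p.2 = p := fun p hp =>
    h.injOn_snd.leftInvOn_invFunOn hp
  obtain ⟨g, hg⟩ := Finset.exists_equiv_extend_of_card_eq (α := V) (t := (Finset.univ : Finset V))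
    Finset.card_univ.symm (s := P.image Prod.snd)
    (f := fun v => (Function.invFunOn Prod.snd (P : Set (V × V)) v).1) (Finset.subset_univ _)
    (by
      intro v hv w hw hvw
      obtain ⟨p, hp, rfl⟩ := Finset.mem_image.1 (Finset.mem_coe.1 hv)
      obtain ⟨q, hq, rfl⟩ := Finset.mem_image.1 (Finset.mem_coe.1 hw)
      simp only [hinv p hp, hinv q hq] at hvw
      rw [h.injOn_fst hp hq hvw])
  let g' : Equiv.Perm V := g.trans (Equiv.subtypeUnivEquiv fun v => Finset.mem_univ v)
  have hg' : ∀ p ∈ P, g' p.2 = p.1 := fun p hp => by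
    have := hg p.2 (Finset.mem_image_of_mem _ hp)
    rw [hinv p hp] at this
    exact this
  refine ⟨g', fun γ hγ => ?_⟩
  have hsub : (Finset.univ.filter fun v => a γ (g' v) ≠ g' (b γ v)) ⊆
      (P.image Prod.snd)ᶜ ∪ (P.filter fun p => (a γ p.1, b γ p.2) ∉ P).image Prod.snd := by
    intro v hv
    by_cases hvP : v ∈ P.image Prod.snd
    · obtain ⟨p, hp, rfl⟩ := Finset.mem_image.1 hvP
      refine Finset.mem_union_right _ (Finset.mem_image_of_mem _ (Finset.mem_filter.2 ⟨hp, ?_⟩))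
      intro hmem
      refine (Finset.mem_filter.1 hv).2 ?_
      rw [hg' p hp, hg' _ hmem]
    · exact Finset.mem_union_left _ (Finset.mem_compl.2 hvP)
  have hcompl : ((P.image Prod.snd)ᶜ.card : ℝ) = Fintype.card V - P.card := by
    rw [Finset.card_compl, Nat.cast_sub (Finset.card_le_univ _),
      Finset.card_image_of_injOn h.injOn_snd]
  have hcard : ((Finset.univ.filter fun v => a γ (g' v) ≠ g' (b γ v)).card : ℝ) ≤
      (P.image Prod.snd)ᶜ.card + (P.filter fun p => (a γ p.1, b γ p.2) ∉ P).card := by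
    exact_mod_cast (Finset.card_le_card hsub).trans ((Finset.card_union_le _ _).trans
      (Nat.add_le_add_left Finset.card_image_le _))
  rw [hcompl] at hcard
  exact hcard.trans (add_le_add_right (h.card_moved γ hγ) _)

/-! ### Amenability implies uniqueness -/

section Folner

variable {Γ : Type*} [Group Γ] [DecidableEq Γ]

/-- A Følner sequence for a generating set is asymptotically invariant under all translations. -/
theorem IsFolnerSeq.tendsto {S : Finset Γ} {F : ℕ → Finset Γ} (h : IsFolnerSeq S F)
    (hgen : Subgroup.closure (S : Set Γ) = ⊤) (γ : Γ) :
    Tendsto (fun n => (((F n).image (· * γ) \ F n).card : ℝ) / (F n).card) atTop (𝓝 0) := by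
  have hγ : γ ∈ Subgroup.closure (S : Set Γ) := hgen ▸ Subgroup.mem_top γ
  induction hγ using Subgroup.closure_induction with
  | mem x hx => exact h.2 x hx
  | one => simp
  | mul x y _ _ hx hy =>
    refine squeeze_zero (fun n => by positivity) (fun n => ?_) (by simpa only [add_zero] using hx.add hy)
    rw [← add_div]
    gcongr
    have hsub : (F n).image (· * (x * y)) \ F n ⊆
        ((F n).image (· * x) \ F n).image (· * y) ∪ ((F n).image (· * y) \ F n) := by
      intro z hz
      simp only [Finset.mem_sdiff, Finset.mem_image, Finset.mem_union] at hz ⊢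
      obtain ⟨⟨f, hf, rfl⟩, hz⟩ := hz
      by_cases hfx : f * x ∈ F n
      · exact Or.inr ⟨⟨f * x, hfx, mul_assoc _ _ _⟩, hz⟩
      · exact Or.inl ⟨f * x, ⟨⟨f, hf, rfl⟩, hfx⟩, mul_assoc _ _ _⟩
    exact_mod_cast (Finset.card_le_card hsub).trans ((Finset.card_union_le _ _).trans
      (Nat.add_le_add_right Finset.card_image_le _))
  | inv x _ hx =>
    refine hx.congr fun n => ?_
    congr 2
    have h1 : ((F n).image (· * x)).card = (F n).card :=
      Finset.card_image_of_injective _ (mul_left_injective x)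
    have h2 : (F n).image (· * x⁻¹) \ F n = (F n \ (F n).image (· * x)).image (· * x⁻¹) := by
      ext z
      simp only [Finset.mem_sdiff, Finset.mem_image]
      constructor
      · rintro ⟨⟨f, hf, rfl⟩, hz⟩
        refine ⟨f, ⟨hf, ?_⟩, rfl⟩
        rintro ⟨f', hf', rfl⟩
        exact hz (by simpa using hf')
      · rintro ⟨f, ⟨hf, hz⟩, rfl⟩
        exact ⟨⟨f, hf, rfl⟩, fun hf' => hz ⟨_, hf', by simp⟩⟩
    rw [h2, Finset.card_image_of_injective _ (mul_left_injective x⁻¹)]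
    exact Finset.card_sdiff_comm h1

/-- A Følner sequence yields finite sets almost invariant under left translations. -/
theorem IsFolnerSeq.exists_invariant {S : Finset Γ} {F : ℕ → Finset Γ} (h : IsFolnerSeq S F)
    (hgen : Subgroup.closure (S : Set Γ) = ⊤) (E : Finset Γ) {ε : ℝ} (hε : 0 < ε) :
    ∃ T : Finset Γ, T.Nonempty ∧
      ∀ γ ∈ E, ((T.filter fun f => γ * f ∉ T).card : ℝ) ≤ ε * T.card := by
  have hev : ∀ᶠ n in atTop, ∀ γ ∈ E,
      (((F n).image (· * γ⁻¹) \ F n).card : ℝ) / (F n).card < ε :=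
    (Filter.eventually_all_finset E).2 fun γ _ =>
      (h.tendsto hgen γ⁻¹).eventually (gt_mem_nhds hε)
  obtain ⟨n, hn⟩ := hev.exists
  have hcard : ((F n).image (·⁻¹)).card = (F n).card :=
    Finset.card_image_of_injective _ inv_injective
  refine ⟨(F n).image (·⁻¹), (h.1 n).image _, fun γ hγ => ?_⟩
  have hpos : (0 : ℝ) < (F n).card := by exact_mod_cast (h.1 n).card_pos
  have h1 := hn γ hγ
  rw [div_lt_iff₀ hpos] at h1
  rw [hcard]
  refine le_trans ?_ h1.le
  refine Nat.cast_le.2 (Finset.card_le_card_of_injOn (fun f => f⁻¹ * γ⁻¹) ?_ ?_)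
  · intro f hf
    simp only [Finset.coe_filter, Finset.mem_image, Set.mem_ofPred_eq, not_exists, not_and] at hf
    obtain ⟨⟨f', hf', rfl⟩, h2⟩ := hf
    simp only [Finset.coe_sdiff, Finset.coe_image, Set.mem_sdiff, Set.mem_image, Finset.mem_coe]
    refine ⟨⟨f', hf', by simp⟩, fun h3 => h2 _ h3 (by simp)⟩
  · intro f _ f' _ hff
    simpa using hff

end Folner

/-- The conditions on a point needed to place a tile of shape `F` there. -/
theorem IsSoficRep.eventually_exists_good_points {Γ : Type*} [Group Γ]
    {φ : Γ → ∀ n : ℕ, Equiv.Perm (Fin n)} {ω : Ultrafilter ℕ} (hω : (ω : Filter ℕ) ≤ cofinite)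
    (h : IsSoficRep ω (fun n => n) φ) (E F : Finset Γ) {η : ℝ} (hη : 0 < η) :
    ∀ᶠ n in (ω : Filter ℕ), ∃ X : Finset (Fin n), (Xᶜ.card : ℝ) ≤ η * n ∧
      (∀ x ∈ X, Set.InjOn (fun f => φ f n x) F) ∧
      ∀ x ∈ X, ∀ γ ∈ E, ∀ f ∈ F, φ (γ * f) n x = φ γ n (φ f n x) := by
  classical
  filter_upwards [((h.negligible_not_injOn hω F).or (h.negligible_exists_mul hω E F)).eventually
    hη] with n hn
  refine ⟨(Finset.univ.filter fun x => ¬ Set.InjOn (fun f => φ f n x) F ∨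
    ∃ γ ∈ E, ∃ f ∈ F, φ (γ * f) n x ≠ φ γ n (φ f n x))ᶜ, ?_, ?_, ?_⟩
  · rwa [compl_compl]
  · intro x hx
    simp only [Finset.mem_compl, Finset.mem_filter, Finset.mem_univ, true_and, not_or,
      not_not] at hx
    exact hx.1
  · intro x hx γ hγ f hf
    simp only [Finset.mem_compl, Finset.mem_filter, Finset.mem_univ, true_and, not_or] at hx
    by_contra hne
    exact hx.2 ⟨γ, hγ, f, hf, hne⟩

section Uniqueness

variable {Γ : Type*} [Group Γ] [DecidableEq Γ] {ω : Ultrafilter ℕ}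
  {φ ψ : Γ → ∀ n : ℕ, Equiv.Perm (Fin n)}

theorem eventually_exists_isAlmostMatching (hω : (ω : Filter ℕ) ≤ cofinite)
    (hφ : IsSoficRep ω (fun n => n) φ) (hψ : IsSoficRep ω (fun n => n) ψ)
    (hamen : ∀ (E : Finset Γ) (ε : ℝ), 0 < ε → ∃ T : Finset Γ, T.Nonempty ∧
      ∀ γ ∈ E, ((T.filter fun f => γ * f ∉ T).card : ℝ) ≤ ε * T.card)
    {θ : ℝ} (hθ : 0 < θ) (hθ' : θ ≤ 1 / 4) (E₀ : Finset Γ) (j : ℕ) :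
    ∀ (E : Finset Γ) (η : ℝ), 0 < η → ∀ᶠ n in (ω : Filter ℕ),
      ∃ (P : Finset (Fin n × Fin n)) (A B : Finset (Fin n)),
        IsAlmostMatching θ E₀ (fun γ => φ γ n) (fun γ => ψ γ n) P A B ∧
        (∀ γ ∈ E, ((A.filter fun v => φ γ n v ∉ A).card : ℝ) ≤ η * n) ∧
        (∀ γ ∈ E, ((B.filter fun v => ψ γ n v ∉ B).card : ℝ) ≤ η * n) ∧
        ((n : ℝ) - A.card) * (n - B.card) ≤ ((1 - θ) ^ j + η) * (n : ℝ) ^ 2 := by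
  induction j with
  | zero =>
    intro E η hη
    filter_upwards with n
    refine ⟨∅, ∅, ∅, ⟨by simp, by simp, by simp, by simp, by simp, by simp, by simp⟩, ?_, ?_, ?_⟩
    · intro γ _
      simp only [Finset.filter_empty, Finset.card_empty, Nat.cast_zero]
      positivity
    · intro γ _
      simp only [Finset.filter_empty, Finset.card_empty, Nat.cast_zero]
      positivity
    · simp only [Finset.card_empty, Nat.cast_zero, sub_zero, pow_zero]
      have : (0 : ℝ) ≤ η * (n : ℝ) ^ 2 := by positivity
      linarith
  | succ j ih =>
    intro E η hη
    set ε := min θ (η / 4) with hε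
    have hε0 : 0 < ε := lt_min hθ (by positivity)
    obtain ⟨F, hFne, hF⟩ := hamen (E₀ ∪ E) ε hε0
    obtain ⟨f₀, hf₀⟩ := id hFne
    have hFpos : (1 : ℝ) ≤ F.card := by exact_mod_cast hFne.card_pos
    set E' := E₀ ∪ E ∪ F.image fun f => f₀ * f⁻¹ with hE'
    have hη' : 0 < η / (4 * F.card) := by positivity
    have hη'le : η / (4 * F.card) ≤ η / 4 := by
      gcongr
      linarith
    have hFη' : F.card * (η / (4 * F.card)) = η / 4 := by field_simp
    filter_upwards [ih E' _ hη', hφ.eventually_exists_good_points hω E' F (η := η / 4)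
      (by positivity), hψ.eventually_exists_good_points hω E' F (η := η / 4) (by positivity)]
      with n ⟨P, A, B, hP, hA, hB, hprod⟩ ⟨X, hXc, hXi, hXm⟩ ⟨Y, hYc, hYi, hYm⟩
    have hsub : E₀ ∪ E ⊆ E' := Finset.subset_union_left
    obtain ⟨P', A', B', hP', hAA', hBB', hA', hB', hmeet⟩ :=
      hP.exists_maximal hθ hθ' hε0.le (min_le_left _ _) (E := E₀ ∪ E) Finset.subset_union_left
        (fun γ hγ => hA γ (hsub hγ)) (fun γ hγ => hB γ (hsub hγ)) hFne hF hXi hYi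
        (fun x hx γ hγ => hXm x hx γ (hsub hγ)) (fun y hy γ hγ => hYm y hy γ (hsub hγ))
    rw [Fintype.card_fin] at hA' hB'
    have hn0 : (0 : ℝ) ≤ n := by positivity
    have hbound : η / (4 * F.card) * n + 2 * ε * n ≤ η * n := by
      have h1 : η / (4 * F.card) * n ≤ η / 4 * n := by gcongr
      have h2 : ε * n ≤ η / 4 * n := by
        gcongr
        exact min_le_right _ _
      linarith
    refine ⟨P', A', B', hP', fun γ hγ => (hA' γ (Finset.mem_union_right _ hγ)).trans hbound,
      fun γ hγ => (hB' γ (Finset.mem_union_right _ hγ)).trans hbound, ?_⟩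
    have hmemE' : ∀ f ∈ F, f₀ * f⁻¹ ∈ E' := fun f hf =>
      Finset.mem_union_right _ (Finset.mem_image_of_mem _ hf)
    have hle : ∀ C : Finset (Fin n), (C.card : ℝ) ≤ n := fun C => by
      exact_mod_cast (Finset.card_le_univ C).trans_eq (Fintype.card_fin n)
    have hmono : ∀ {C C' : Finset (Fin n)}, C ⊆ C' → (C.card : ℝ) ≤ C'.card := fun h => by
      exact_mod_cast Finset.card_le_card h
    have hFβ : F.card * (η / (4 * F.card) * n) = η / 4 * n := by rw [← mul_assoc, hFη']
    have harith : ∀ a b a' b' : ℝ, 0 ≤ a → 0 ≤ b → b ≤ n → 0 ≤ a' → 0 ≤ b' → b' ≤ b →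
        a * b ≤ ((1 - θ) ^ j + η / (4 * F.card)) * (n : ℝ) ^ 2 →
        a' ≤ (1 - θ) * a + θ * (η / 4 * n + η / 4 * n) →
        a' * b' ≤ ((1 - θ) ^ (j + 1) + η) * (n : ℝ) ^ 2 := by
      intro a b a' b' ha hb hbn ha' hb' hbb hab haa
      have hθ1 : 0 ≤ 1 - θ := by linarith
      have h1 : a' * b' ≤ a' * b := mul_le_mul_of_nonneg_left hbb ha'
      have h2 : a' * b ≤ ((1 - θ) * a + θ * (η / 4 * n + η / 4 * n)) * b :=
        mul_le_mul_of_nonneg_right haa hb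
      have h3 := mul_le_mul_of_nonneg_left hab hθ1
      have h4 : θ * (η / 2 * n) * b ≤ 1 * (η / 2 * n) * n := by
        gcongr
        linarith
      have h5 : (1 - θ) * (η / (4 * F.card)) * (n : ℝ) ^ 2 ≤ 1 * (η / 4) * (n : ℝ) ^ 2 := by
        gcongr
        linarith
      have h6 : 0 ≤ η * (n : ℝ) ^ 2 := by positivity
      rw [pow_succ]
      linarith
    rcases hmeet with hmeet | hmeet
    · have := le_card_sdiff_of_tiles_meet hθ.le (a := fun γ => φ γ n) hAA' hf₀
        (fun f hf => hA _ (hmemE' f hf))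
        (fun x hx f hf => by simpa using hXm x hx _ (hmemE' f hf) f hf) hmeet
      rw [Fintype.card_fin, hFβ] at this
      refine harith (n - A.card) (n - B.card) _ _ ?_ ?_ ?_ ?_ ?_ ?_ hprod
        (this.trans (by gcongr))
      all_goals linarith [hle A, hle B, hle A', hle B', hmono hBB',
        (Nat.cast_nonneg B.card : (0 : ℝ) ≤ _)]
    · have := le_card_sdiff_of_tiles_meet hθ.le (a := fun γ => ψ γ n) hBB' hf₀
        (fun f hf => hB _ (hmemE' f hf))
        (fun x hx f hf => by simpa using hYm x hx _ (hmemE' f hf) f hf) hmeet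
      rw [Fintype.card_fin, hFβ] at this
      rw [mul_comm] at hprod ⊢
      refine harith (n - B.card) (n - A.card) _ _ ?_ ?_ ?_ ?_ ?_ ?_ hprod
        (this.trans (by gcongr))
      all_goals linarith [hle A, hle B, hle A', hle B', hmono hAA',
        (Nat.cast_nonneg A.card : (0 : ℝ) ≤ _)]

theorem eventually_exists_perm (hω : (ω : Filter ℕ) ≤ cofinite)
    (hφ : IsSoficRep ω (fun n => n) φ) (hψ : IsSoficRep ω (fun n => n) ψ)
    (hamen : ∀ (E : Finset Γ) (ε : ℝ), 0 < ε → ∃ T : Finset Γ, T.Nonempty ∧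
      ∀ γ ∈ E, ((T.filter fun f => γ * f ∉ T).card : ℝ) ≤ ε * T.card)
    (E : Finset Γ) {ε : ℝ} (hε : 0 < ε) :
    ∀ᶠ n in (ω : Filter ℕ), ∃ g : Equiv.Perm (Fin n), ∀ γ ∈ E,
      ((Finset.univ.filter fun v => φ γ n (g v) ≠ g (ψ γ n v)).card : ℝ) ≤ ε * n := by
  set θ := min (1 / 4) (ε / 9) with hθdef
  have hθ : 0 < θ := lt_min (by norm_num) (by positivity)
  have hθ4 : θ ≤ 1 / 4 := min_le_left _ _
  have hθε : 9 * θ ≤ ε := by linarith [min_le_right (1 / 4) (ε / 9)]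
  obtain ⟨j, hj⟩ := exists_pow_lt_of_lt_one (show (0 : ℝ) < θ ^ 2 / 2 by positivity)
    (show 1 - θ < 1 by linarith)
  filter_upwards [eventually_exists_isAlmostMatching hω hφ hψ hamen hθ hθ4 E j ∅ (θ ^ 2 / 2)
    (by positivity)] with n ⟨P, A, B, hP, _, _, hprod⟩
  obtain ⟨g, hg⟩ := hP.exists_perm
  refine ⟨g, fun γ hγ => (hg γ hγ).trans ?_⟩
  rw [Fintype.card_fin]
  have hn0 : (0 : ℝ) ≤ n := by positivity
  have hPn : (P.card : ℝ) ≤ n := by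
    rw [← Finset.card_image_of_injOn hP.injOn_fst]
    exact_mod_cast (Finset.card_le_univ _).trans_eq (Fintype.card_fin n)
  have hAB : (n : ℝ) - A.card ≤ θ * n ∨ (n : ℝ) - B.card ≤ θ * n := by
    by_contra! hcon
    have h1 : (θ * n) * (θ * n) < ((n : ℝ) - A.card) * (n - B.card) :=
      mul_lt_mul'' hcon.1 hcon.2 (by positivity) (by positivity)
    have h2 : ((1 - θ) ^ j + θ ^ 2 / 2) * (n : ℝ) ^ 2 ≤ θ ^ 2 * (n : ℝ) ^ 2 := by
      gcongr
      linarith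
    nlinarith
  have hbig : (1 - 3 * θ) * n ≤ P.card := by
    have hpos : 0 ≤ 1 - 2 * θ := by linarith
    have h2 : 0 ≤ θ * θ * n := by positivity
    rcases hAB with hA | hB
    · have := mul_le_mul_of_nonneg_left hA hpos
      linarith [hP.card_fst]
    · have := mul_le_mul_of_nonneg_left hB hpos
      linarith [hP.card_snd]
  have h1 : θ * P.card ≤ θ * n := by gcongr
  have h2 : 9 * θ * n ≤ ε * n := by gcongr
  linarith

/-- Any two sofic representations of a countable amenable group are conjugate. -/
theorem conjugateReps_of_amenable [Countable Γ] (hω : (ω : Filter ℕ) ≤ cofinite)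
    (hφ : IsSoficRep ω (fun n => n) φ) (hψ : IsSoficRep ω (fun n => n) ψ)
    (hamen : ∀ (E : Finset Γ) (ε : ℝ), 0 < ε → ∃ T : Finset Γ, T.Nonempty ∧
      ∀ γ ∈ E, ((T.filter fun f => γ * f ∉ T).card : ℝ) ≤ ε * T.card) :
    ConjugateReps ω (fun n => n) φ ψ := by
  obtain ⟨e, he⟩ := exists_surjective_nat Γ
  obtain ⟨J, hJ, hev⟩ := exists_tendsto_of_eventually hω
    (P := fun j n => ∃ g : Equiv.Perm (Fin n), ∀ γ ∈ (Finset.range j).image e,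
      ((Finset.univ.filter fun v => φ γ n (g v) ≠ g (ψ γ n v)).card : ℝ) ≤ (1 / (j + 1)) * n)
    (fun j => eventually_exists_perm hω hφ hψ hamen _ (by positivity))
  have hchoice : ∀ n : ℕ, ∃ g : Equiv.Perm (Fin n), (∃ g : Equiv.Perm (Fin n),
      ∀ γ ∈ (Finset.range (J n)).image e, ((Finset.univ.filter fun v =>
        φ γ n (g v) ≠ g (ψ γ n v)).card : ℝ) ≤ (1 / (J n + 1)) * n) →
      ∀ γ ∈ (Finset.range (J n)).image e, ((Finset.univ.filter fun v =>
        φ γ n (g v) ≠ g (ψ γ n v)).card : ℝ) ≤ (1 / (J n + 1)) * n := fun n => by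
    by_cases h : ∃ g : Equiv.Perm (Fin n), ∀ γ ∈ (Finset.range (J n)).image e,
      ((Finset.univ.filter fun v => φ γ n (g v) ≠ g (ψ γ n v)).card : ℝ) ≤ (1 / (J n + 1)) * n
    · exact h.imp fun g hg _ => hg
    · exact ⟨1, fun h' => absurd h' h⟩
  choose g hg using hchoice
  refine (conjugateReps_iff hω φ ψ).2 ⟨g, fun γ => Negligible.of_forall fun η hη => ?_⟩
  obtain ⟨i, rfl⟩ := he γ
  obtain ⟨k, hk⟩ := exists_nat_one_div_lt hη
  filter_upwards [hev, hJ.eventually_ge_atTop (max (i + 1) k)] with n h1 h2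
  refine (hg n h1 (e i) (Finset.mem_image_of_mem _ (Finset.mem_range.2 ?_))).trans ?_
  · exact (le_max_left _ _).trans h2
  · have : k ≤ J n := (le_max_right _ _).trans h2
    gcongr
    refine le_trans ?_ hk.le
    gcongr

end Uniqueness

/-! ### Uniqueness implies amenability -/

section BlockPerm

/-- Splitting `Fin n` into `n / N` blocks of size `N` and a remainder. -/
noncomputable def blockEquiv (n N : ℕ) : Fin n ≃ (Fin (n / N) × Fin N) ⊕ Fin (n % N) :=
  Fintype.equivOfCardEq (by simp [Nat.div_add_mod'])

/-- The permutation of `Fin n` acting as `σ` on each block and trivially on the remainder. -/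
noncomputable def blockPerm (n : ℕ) {N : ℕ} (σ : Equiv.Perm (Fin N)) : Equiv.Perm (Fin n) :=
  (blockEquiv n N).symm.permCongr
    (Equiv.sumCongr (Equiv.prodCongr (Equiv.refl _) σ) (Equiv.refl _))

/-- The block containing a point. -/
noncomputable def blockLabel (n N : ℕ) (x : Fin n) : Fin (n / N) ⊕ Unit :=
  Sum.map Prod.fst (fun _ => ()) (blockEquiv n N x)

variable {n N : ℕ}

theorem blockEquiv_blockPerm (σ : Equiv.Perm (Fin N)) (x : Fin n) :
    blockEquiv n N (blockPerm n σ x) =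
      Sum.map (fun p => (p.1, σ p.2)) id (blockEquiv n N x) := by
  simp only [blockPerm, Equiv.permCongr_apply, Equiv.apply_symm_apply, Equiv.symm_symm]
  rcases blockEquiv n N x with ⟨q, r⟩ | y <;> rfl

theorem blockLabel_blockPerm (σ : Equiv.Perm (Fin N)) (x : Fin n) :
    blockLabel n N (blockPerm n σ x) = blockLabel n N x := by
  rw [blockLabel, blockLabel, blockEquiv_blockPerm]
  rcases blockEquiv n N x with ⟨q, r⟩ | y <;> rfl

theorem card_blockLabel_le (hN : 0 < N) (i : Fin (n / N) ⊕ Unit) :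
    (Finset.univ.filter fun x => blockLabel n N x = i).card ≤ N := by
  rcases i with q | u
  · have hsub : (Finset.univ.filter fun x => blockLabel n N x = Sum.inl q) ⊆
        Finset.univ.image fun r : Fin N => (blockEquiv n N).symm (Sum.inl (q, r)) := by
      intro x hx
      have hx := (Finset.mem_filter.1 hx).2
      rw [blockLabel] at hx
      rcases hz : blockEquiv n N x with ⟨q', r⟩ | y
      · rw [hz] at hx
        obtain rfl : q' = q := by simpa using hx
        exact Finset.mem_image.2 ⟨r, Finset.mem_univ _, by rw [← hz, Equiv.symm_apply_apply]⟩
      · simp [hz] at hx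
    exact (Finset.card_le_card hsub).trans (Finset.card_image_le.trans (by simp))
  · have hsub : (Finset.univ.filter fun x => blockLabel n N x = Sum.inr u) ⊆
        Finset.univ.image fun r : Fin (n % N) => (blockEquiv n N).symm (Sum.inr r) := by
      intro x hx
      have hx := (Finset.mem_filter.1 hx).2
      rw [blockLabel] at hx
      rcases hz : blockEquiv n N x with ⟨q', r⟩ | y
      · simp [hz] at hx
      · exact Finset.mem_image.2 ⟨y, Finset.mem_univ _, by rw [← hz, Equiv.symm_apply_apply]⟩
    exact (Finset.card_le_card hsub).trans (Finset.card_image_le.trans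
      (by simpa using (Nat.mod_lt n hN).le))

/-- A block-wise property holds for at most the corresponding proportion of points, up to the
remainder. -/
theorem card_le_of_blockwise {p : Fin n → Prop} [DecidablePred p] {q : Fin N → Prop}
    [DecidablePred q] {η : ℝ} (hq : ((Finset.univ.filter q).card : ℝ) ≤ η * N) {M : ℕ}
    (hpq : ∀ i r, p ((blockEquiv n N).symm (Sum.inl (i, r))) → q r)
    (hM : (Finset.univ.filter fun y => p ((blockEquiv n N).symm (Sum.inr y))).card ≤ M)
    (hη : 0 ≤ η) :
    ((Finset.univ.filter p).card : ℝ) ≤ η * n + M := by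
  have hsub : Finset.univ.filter p ⊆
      ((Finset.univ ×ˢ Finset.univ.filter q).image fun z => (blockEquiv n N).symm (Sum.inl z)) ∪
        (Finset.univ.filter fun y => p ((blockEquiv n N).symm (Sum.inr y))).image
          fun y => (blockEquiv n N).symm (Sum.inr y) := by
    intro x hx
    have hx := (Finset.mem_filter.1 hx).2
    obtain ⟨z, rfl⟩ := (blockEquiv n N).symm.surjective x
    rcases z with ⟨i, r⟩ | y
    · refine Finset.mem_union_left _ (Finset.mem_image_of_mem
        (fun z => (blockEquiv n N).symm (Sum.inl z)) ?_)
      simpa using hpq i r hx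
    · refine Finset.mem_union_right _ (Finset.mem_image_of_mem
        (fun y => (blockEquiv n N).symm (Sum.inr y)) ?_)
      simpa using hx
  have h1 : (Finset.univ.filter p).card ≤ n / N * (Finset.univ.filter q).card + M := by
    refine (Finset.card_le_card hsub).trans ((Finset.card_union_le _ _).trans
      (Nat.add_le_add (Finset.card_image_le.trans ?_) (Finset.card_image_le.trans hM)))
    rw [Finset.card_product, Finset.card_univ, Fintype.card_fin]
  have h2 : ((n / N : ℕ) : ℝ) * N ≤ n := by exact_mod_cast Nat.div_mul_le_self n N
  calc ((Finset.univ.filter p).card : ℝ)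
      ≤ (n / N : ℕ) * (Finset.univ.filter q).card + M := by exact_mod_cast h1
    _ ≤ (n / N : ℕ) * (η * N) + M := by gcongr
    _ = η * ((n / N : ℕ) * N) + M := by ring
    _ ≤ η * n + M := by gcongr

theorem card_blockPerm_mul_le {σ τ υ : Equiv.Perm (Fin N)} {η : ℝ} (hη : 0 ≤ η)
    (h : ((Finset.univ.filter fun x => υ x ≠ σ (τ x)).card : ℝ) ≤ η * N) :
    ((Finset.univ.filter fun x : Fin n =>
      blockPerm n υ x ≠ blockPerm n σ (blockPerm n τ x)).card : ℝ) ≤ η * n := by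
  have := card_le_of_blockwise (n := n) (p := fun x =>
    blockPerm n υ x ≠ blockPerm n σ (blockPerm n τ x)) h (M := 0) (fun i r hp => ?_) ?_ hη
  · simpa using this
  · refine fun h' => hp ((blockEquiv n N).injective ?_)
    simp [blockEquiv_blockPerm, h']
  · rw [Nat.le_zero, Finset.card_eq_zero, Finset.filter_eq_empty_iff]
    intro y _
    rw [not_not]
    refine (blockEquiv n N).injective ?_
    simp [blockEquiv_blockPerm]

theorem card_blockPerm_fixed_le (hN : 0 < N) {σ : Equiv.Perm (Fin N)} {η : ℝ} (hη : 0 ≤ η)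
    (h : ((Finset.univ.filter fun x => σ x = x).card : ℝ) ≤ η * N) :
    ((Finset.univ.filter fun x : Fin n => blockPerm n σ x = x).card : ℝ) ≤ η * n + N := by
  refine card_le_of_blockwise h (fun i r hp => ?_) ((Finset.card_le_univ _).trans ?_) hη
  · have := congrArg (blockEquiv n N) hp
    simpa [blockEquiv_blockPerm] using this
  · simpa using (Nat.mod_lt n hN).le

end BlockPerm

section Isoperimetry

open scoped Pointwise

variable {Γ V : Type*} [Group Γ] [DecidableEq Γ] [DecidableEq V]

/-- Small sets of points with good neighbourhoods in a graph modelled on a non-amenable group have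
large boundary. -/
theorem mul_card_le_sum_card_boundary {S : Finset Γ} (hsym : ∀ s ∈ S, s⁻¹ ∈ S) {δ : ℝ}
    (hδ : ∀ F : Finset Γ, F.Nonempty →
      ∃ s ∈ S, δ * F.card ≤ ((F.filter fun f => s * f ∉ F).card : ℝ))
    {a : Γ → Equiv.Perm V} {K : ℕ} (C : Finset V) (hK : C.card ≤ K)
    (hone : ∀ v ∈ C, a 1 v = v)
    (hinv : ∀ v ∈ C, ∀ s ∈ S, a s⁻¹ (a s v) = v)
    (hinj : ∀ v ∈ C, Set.InjOn (fun γ => a γ v) ((insert 1 S ^ (K + 1) : Finset Γ) : Set Γ))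
    (hmul : ∀ v ∈ C, ∀ s ∈ S, ∀ γ ∈ insert 1 S ^ (K + 1), a (s * γ) v = a s (a γ v)) :
    δ * C.card ≤ ∑ s ∈ S, ((C.filter fun c => a s c ∉ C).card : ℝ) := by
  induction C using Finset.strongInduction with
  | H C ih =>
  rcases C.eq_empty_or_nonempty with rfl | ⟨v, hv⟩
  · simp
  set U := insert 1 S with hU
  have h1U : (1 : Γ) ∈ U := Finset.mem_insert_self _ _
  let fam := (U ^ (K + 1)).powerset.filter fun F =>
    1 ∈ F ∧ F ⊆ U ^ F.card ∧ ∀ f ∈ F, a f v ∈ C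
  have hfam : ({1} : Finset Γ) ∈ fam := by
    simp only [fam, Finset.mem_filter, Finset.mem_powerset, Finset.singleton_subset_iff,
      Finset.mem_singleton, true_and, forall_eq, Finset.card_singleton, pow_one]
    exact ⟨Finset.one_mem_pow h1U, h1U, by rwa [hone v hv]⟩
  obtain ⟨F, hF, hmax⟩ := Finset.exists_max_image fam Finset.card ⟨_, hfam⟩
  simp only [fam, Finset.mem_filter, Finset.mem_powerset] at hF hmax
  obtain ⟨hFU, h1F, hFball, hFC⟩ := hF
  have hFinj : Set.InjOn (fun f => a f v) (F : Set Γ) :=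
    (hinj v hv).mono (by exact_mod_cast hFU)
  set D := F.image fun f => a f v with hD
  have hDF : D.card = F.card := Finset.card_image_of_injOn hFinj
  have hDC : D ⊆ C := by
    intro d hd
    obtain ⟨f, hf, rfl⟩ := Finset.mem_image.1 hd
    exact hFC f hf
  have hleave : ∀ s ∈ S, ∀ f ∈ F, s * f ∉ F → a s (a f v) ∉ C := by
    intro s hs f hf hsf hC
    have hcard : (insert (s * f) F).card = F.card + 1 := Finset.card_insert_of_notMem hsf
    have hFK : F.card + 1 ≤ K + 1 := by
      have := Finset.card_le_card hDC
      omega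
    have hball : insert (s * f) F ⊆ U ^ (F.card + 1) := by
      rw [Finset.insert_subset_iff]
      refine ⟨?_, hFball.trans (Finset.pow_subset_pow_right h1U (Nat.le_succ _))⟩
      rw [pow_succ']
      exact Finset.mul_mem_mul (Finset.mem_insert_of_mem hs) (hFball hf)
    have := hmax (insert (s * f) F) ⟨hball.trans (Finset.pow_subset_pow_right h1U hFK),
      Finset.mem_insert_of_mem h1F, by rwa [hcard], by
        intro g hg
        rcases Finset.mem_insert.1 hg with rfl | hg
        · rwa [hmul v hv s hs f (hFU hf)]
        · exact hFC g hg⟩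
    omega
  have hclosed : ∀ s ∈ S, ∀ d ∈ D, a s d ∈ C → a s d ∈ D := by
    intro s hs d hd hC
    obtain ⟨f, hf, rfl⟩ := Finset.mem_image.1 hd
    by_cases hsf : s * f ∈ F
    · rw [← hmul v hv s hs f (hFU hf)]
      exact Finset.mem_image_of_mem (fun f => a f v) hsf
    · exact absurd hC (hleave s hs f hf hsf)
  have hDbd : δ * D.card ≤ ∑ s ∈ S, ((D.filter fun d => a s d ∉ C).card : ℝ) := by
    obtain ⟨s, hs, hsF⟩ := hδ F ⟨1, h1F⟩
    rw [hDF]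
    refine hsF.trans (le_trans ?_ (Finset.single_le_sum (f := fun s =>
      ((D.filter fun d => a s d ∉ C).card : ℝ)) (fun _ _ => by positivity) hs))
    refine Nat.cast_le.2 (Finset.card_le_card_of_injOn (fun f => a f v) ?_
      (hFinj.mono (by exact_mod_cast Finset.filter_subset _ _)))
    intro f hf
    have hf := Finset.mem_filter.1 (Finset.mem_coe.1 hf)
    exact Finset.mem_coe.2 (Finset.mem_filter.2
      ⟨Finset.mem_image_of_mem _ hf.1, hleave s hs f hf.1 hf.2⟩)
  have hCD : C \ D ⊂ C := by
    refine Finset.sdiff_ssubset hDC ⟨a 1 v, Finset.mem_image_of_mem (fun f => a f v) h1F⟩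
  have hsubC : ∀ {w}, w ∈ C \ D → w ∈ C := fun hw => (Finset.mem_sdiff.1 hw).1
  have hrec := ih (C \ D) hCD ((Finset.card_le_card hCD.1).trans hK)
    (fun w hw => hone w (hsubC hw)) (fun w hw => hinv w (hsubC hw))
    (fun w hw => hinj w (hsubC hw)) (fun w hw => hmul w (hsubC hw))
  have hcardCD : ((C \ D).card : ℝ) + D.card = C.card := by
    exact_mod_cast Finset.card_sdiff_add_card_eq_card hDC
  have hsplit : ∀ s ∈ S, (((C \ D).filter fun c => a s c ∉ C \ D).card : ℝ) +
      (D.filter fun d => a s d ∉ C).card ≤ (C.filter fun c => a s c ∉ C).card := by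
    intro s hs
    have hdisj : Disjoint ((C \ D).filter fun c => a s c ∉ C \ D)
        (D.filter fun d => a s d ∉ C) :=
      (Finset.sdiff_disjoint).mono (Finset.filter_subset _ _) (Finset.filter_subset _ _)
    rw [← Nat.cast_add, ← Finset.card_union_of_disjoint hdisj]
    refine Nat.cast_le.2 (Finset.card_le_card ?_)
    intro c hc
    rcases Finset.mem_union.1 hc with hc | hc
    · obtain ⟨hc, hout⟩ := Finset.mem_filter.1 hc
      refine Finset.mem_filter.2 ⟨hsubC hc, fun hin => hout (Finset.mem_sdiff.2 ⟨hin, ?_⟩)⟩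
      intro hinD
      refine (Finset.mem_sdiff.1 hc).2 ?_
      have hback := hinv c (hsubC hc) s hs
      have := hclosed s⁻¹ (hsym s hs) _ hinD (by rw [hback]; exact hsubC hc)
      rwa [hback] at this
    · obtain ⟨hc, hout⟩ := Finset.mem_filter.1 hc
      exact Finset.mem_filter.2 ⟨hDC hc, hout⟩
  have hsum := Finset.sum_le_sum hsplit
  rw [Finset.sum_add_distrib] at hsum
  rw [← hcardCD, mul_add]
  linarith

/-- If `V` is split into small pieces, then many edges join different pieces or meet the set of
bad points. -/
theorem mul_card_le_of_partition [Fintype V] {S : Finset Γ} (hsym : ∀ s ∈ S, s⁻¹ ∈ S) {δ : ℝ}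
    (hδ : ∀ F : Finset Γ, F.Nonempty →
      ∃ s ∈ S, δ * F.card ≤ ((F.filter fun f => s * f ∉ F).card : ℝ))
    {a : Γ → Equiv.Perm V} {K : ℕ} (X : Finset V)
    (hone : ∀ v ∈ X, a 1 v = v)
    (hinv : ∀ v ∈ X, ∀ s ∈ S, a s⁻¹ (a s v) = v)
    (hinj : ∀ v ∈ X, Set.InjOn (fun γ => a γ v) ((insert 1 S ^ (K + 1) : Finset Γ) : Set Γ))
    (hmul : ∀ v ∈ X, ∀ s ∈ S, ∀ γ ∈ insert 1 S ^ (K + 1), a (s * γ) v = a s (a γ v))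
    {ι : Type*} [Fintype ι] [DecidableEq ι] (l : V → ι)
    (hl : ∀ i, (Finset.univ.filter fun v => l v = i).card ≤ K) :
    δ * X.card ≤ ∑ s ∈ S, ((Finset.univ.filter fun v => l (a s v) ≠ l v).card + Xᶜ.card : ℝ) := by
  have hpiece : ∀ i : ι, δ * (X.filter fun v => l v = i).card ≤ ∑ s ∈ S,
      (((X.filter fun v => l (a s v) ≠ l v ∨ a s v ∉ X).filter fun v => l v = i).card : ℝ) := by
    intro i
    have hsub : ∀ {v}, v ∈ X.filter (fun v => l v = i) → v ∈ X := fun h => (Finset.mem_filter.1 h).1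
    refine (mul_card_le_sum_card_boundary hsym hδ (a := a) (K := K) (X.filter fun v => l v = i)
      ((Finset.card_le_card (Finset.filter_subset_filter _ (Finset.subset_univ _))).trans (hl i))
      (fun v hv => hone v (hsub hv)) (fun v hv => hinv v (hsub hv))
      (fun v hv => hinj v (hsub hv)) (fun v hv => hmul v (hsub hv))).trans ?_
    refine Finset.sum_le_sum fun s _ => Nat.cast_le.2 (Finset.card_le_card ?_)
    intro v hv
    simp only [Finset.mem_filter, not_and] at hv ⊢
    obtain ⟨⟨hvX, rfl⟩, hout⟩ := hv
    refine ⟨⟨hvX, ?_⟩, rfl⟩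
    by_cases h : a s v ∈ X
    · exact Or.inl (hout h)
    · exact Or.inr h
  have hfib : ∀ Y : Finset V, (Y.card : ℝ) = ∑ i : ι, ((Y.filter fun v => l v = i).card : ℝ) := by
    intro Y
    exact_mod_cast Finset.card_eq_sum_card_fiberwise (fun v _ => Finset.mem_coe.2 (Finset.mem_univ _))
  rw [hfib X, Finset.mul_sum]
  refine (Finset.sum_le_sum fun i _ => hpiece i).trans ?_
  rw [Finset.sum_comm]
  refine Finset.sum_le_sum fun s _ => ?_
  rw [← hfib]
  have hsub : (X.filter fun v => l (a s v) ≠ l v ∨ a s v ∉ X) ⊆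
      (Finset.univ.filter fun v => l (a s v) ≠ l v) ∪ (Xᶜ).image (a s).symm := by
    intro v hv
    obtain ⟨_, hv | hv⟩ := Finset.mem_filter.1 hv
    · exact Finset.mem_union_left _ (Finset.mem_filter.2 ⟨Finset.mem_univ _, hv⟩)
    · exact Finset.mem_union_right _ (Finset.mem_image.2 ⟨a s v, Finset.mem_compl.2 hv, by simp⟩)
  exact_mod_cast (Finset.card_le_card hsub).trans ((Finset.card_union_le _ _).trans
    (Nat.add_le_add_left Finset.card_image_le _))

end Isoperimetry

theorem exists_expansion_of_not_folner {Γ : Type*} [Group Γ] [DecidableEq Γ] (S : Finset Γ)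
    (hsym : ∀ s ∈ S, s⁻¹ ∈ S) (h : ¬ ∃ F : ℕ → Finset Γ, IsFolnerSeq S F) :
    ∃ δ : ℝ, 0 < δ ∧ ∀ F : Finset Γ, F.Nonempty →
      ∃ s ∈ S, δ * F.card ≤ ((F.filter fun f => s * f ∉ F).card : ℝ) := by
  by_contra! hcon
  choose F hFne hF using fun m : ℕ => hcon (1 / ((m : ℝ) + 1)) (by positivity)
  refine h ⟨fun m => (F m).image (·⁻¹), fun m => (hFne m).image _, fun s hs => ?_⟩
  refine squeeze_zero (fun m => by positivity) (fun m => ?_)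
    tendsto_one_div_add_atTop_nhds_zero_nat
  have hpos : (0 : ℝ) < (F m).card := by exact_mod_cast (hFne m).card_pos
  rw [Finset.card_image_of_injective _ inv_injective, div_le_iff₀ hpos]
  refine le_trans ?_ (hF m s⁻¹ (hsym s hs)).le
  refine Nat.cast_le.2 (Finset.card_le_card_of_injOn (fun z => s * z⁻¹) ?_ ?_)
  · intro z hz
    obtain ⟨hz, hz'⟩ := Finset.mem_sdiff.1 (Finset.mem_coe.1 hz)
    obtain ⟨w, hw, rfl⟩ := Finset.mem_image.1 hz
    obtain ⟨f, hf, rfl⟩ := Finset.mem_image.1 hw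
    refine Finset.mem_coe.2 (Finset.mem_filter.2 ⟨?_, fun h => hz' ?_⟩)
    · simpa using hf
    · exact Finset.mem_image.2 ⟨_, h, by simp⟩
  · intro z _ w _ hzw
    simpa using hzw

theorem countable_of_closure_eq_top {Γ : Type*} [Group Γ] (S : Finset Γ)
    (hgen : Subgroup.closure (S : Set Γ) = ⊤) : Countable Γ := by
  have hsurj : Function.Surjective (FreeGroup.lift ((↑) : S → Γ)) := by
    rw [← MonoidHom.range_eq_top, FreeGroup.range_lift_eq_closure]
    simpa using hgen
  exact hsurj.countable

open scoped Pointwise in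
/-- A sofic representation of a non-amenable group is not conjugate to a suitable representation
made of small blocks. -/
theorem IsSoficRep.exists_not_conjugateReps {Γ : Type*} [Group Γ] [DecidableEq Γ] [Countable Γ]
    {ω : Ultrafilter ℕ} (hω : (ω : Filter ℕ) ≤ cofinite) {φ : Γ → ∀ n : ℕ, Equiv.Perm (Fin n)}
    (hφ : IsSoficRep ω (fun n => n) φ) {S : Finset Γ} (hsym : ∀ s ∈ S, s⁻¹ ∈ S) {δ : ℝ}
    (hδ : 0 < δ) (hexp : ∀ F : Finset Γ, F.Nonempty →
      ∃ s ∈ S, δ * F.card ≤ ((F.filter fun f => s * f ∉ F).card : ℝ)) :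
    ∃ ψ : Γ → ∀ n : ℕ, Equiv.Perm (Fin n), IsSoficRep ω (fun n => n) ψ ∧
      ¬ ConjugateReps ω (fun n => n) φ ψ := by
  classical
  obtain ⟨e, he⟩ := exists_surjective_nat Γ
  have hlarge : ∀ m : ℕ, ∀ᶠ n in (ω : Filter ℕ), m ≤ n := fun m => by
    apply hω
    rw [Nat.cofinite_eq_atTop]
    exact eventually_ge_atTop m
  have hmodel : ∀ j : ℕ, ∃ N : ℕ, 0 < N ∧
      (∀ i < j, ∀ k < j, ((Finset.univ.filter fun x =>
        φ (e i * e k) N x ≠ φ (e i) N (φ (e k) N x)).card : ℝ) ≤ 1 / ((j : ℝ) + 1) * N) ∧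
      (∀ i < j, e i ≠ 1 → ((Finset.univ.filter fun x => φ (e i) N x = x).card : ℝ) ≤
        1 / ((j : ℝ) + 1) * N) := fun j => by
    have hη : 0 < 1 / ((j : ℝ) + 1) := by positivity
    have h1 : ∀ᶠ N in (ω : Filter ℕ), ∀ i ∈ Finset.range j, ∀ k ∈ Finset.range j,
        ((Finset.univ.filter fun x =>
          φ (e i * e k) N x ≠ φ (e i) N (φ (e k) N x)).card : ℝ) ≤ 1 / ((j : ℝ) + 1) * N :=
      (Filter.eventually_all_finset _).2 fun i _ => (Filter.eventually_all_finset _).2 fun k _ =>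
        (hφ.negligible_mul hω (e i) (e k)).eventually hη
    have h2 : ∀ᶠ N in (ω : Filter ℕ), ∀ i ∈ Finset.range j, e i ≠ 1 →
        ((Finset.univ.filter fun x => φ (e i) N x = x).card : ℝ) ≤ 1 / ((j : ℝ) + 1) * N :=
      (Filter.eventually_all_finset _).2 fun i _ => by
        by_cases hi : e i = 1
        · exact Filter.Eventually.of_forall fun _ h => absurd hi h
        · filter_upwards [(((isSoficRep_iff hω φ).1 hφ).2 (e i) hi).eventually hη] with N hN _
          exact hN
    obtain ⟨N, h1, h2, h3⟩ := (h1.and (h2.and (hlarge 1))).exists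
    exact ⟨N, h3, fun i hi k hk => h1 i (Finset.mem_range.2 hi) k (Finset.mem_range.2 hk),
      fun i hi => h2 i (Finset.mem_range.2 hi)⟩
  choose N hNpos hNmul hNfix using hmodel
  let bad : ℕ → ∀ n : ℕ, Fin n → Prop := fun K n x =>
    (φ 1 n x ≠ x ∨ ∃ s ∈ S, φ s⁻¹ n (φ s n x) ≠ x) ∨
      (¬ Set.InjOn (fun γ => φ γ n x) ((insert 1 S ^ (K + 1) : Finset Γ) : Set Γ) ∨
        ∃ s ∈ S, ∃ γ ∈ insert 1 S ^ (K + 1), φ (s * γ) n x ≠ φ s n (φ γ n x))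
  have hbad : ∀ K, Negligible ω (bad K) := fun K =>
    ((hφ.negligible_one hω).or (Negligible.exists_mem S fun s _ => hφ.negligible_inv hω s)).or
      ((hφ.negligible_not_injOn hω _).or (hφ.negligible_exists_mul hω S _))
  obtain ⟨J, hJ, hev⟩ := exists_tendsto_of_eventually hω
    (P := fun j n => (N j : ℝ) ≤ 1 / ((j : ℝ) + 1) * n ∧
      ((Finset.univ.filter (bad (N j) n)).card : ℝ) ≤ 1 / ((j : ℝ) + 1) * n) fun j => by
    filter_upwards [(hbad (N j)).eventually (show 0 < 1 / ((j : ℝ) + 1) by positivity),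
      hlarge ((j + 1) * N j)] with n h1 h2
    refine ⟨?_, h1⟩
    rw [one_div, inv_mul_eq_div, le_div_iff₀ (by positivity), mul_comm]
    exact_mod_cast h2
  have hsmall : ∀ η : ℝ, 0 < η → ∀ᶠ n in (ω : Filter ℕ), 1 / ((J n : ℝ) + 1) ≤ η := by
    intro η hη
    obtain ⟨k, hk⟩ := exists_nat_one_div_lt hη
    filter_upwards [hJ.eventually_ge_atTop k] with n hn
    refine le_trans ?_ hk.le
    gcongr
  let ψ : Γ → ∀ n : ℕ, Equiv.Perm (Fin n) := fun γ n => blockPerm n (φ γ (N (J n)))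
  refine ⟨ψ, (isSoficRep_iff hω ψ).2 ⟨fun γ γ' => ?_, fun γ hγ => ?_⟩, fun hconj => ?_⟩
  · obtain ⟨i, rfl⟩ := he γ
    obtain ⟨k, rfl⟩ := he γ'
    refine Negligible.of_forall fun η hη => ?_
    filter_upwards [hsmall η hη, hJ.eventually_gt_atTop (max i k)] with n h1 h2
    refine (card_blockPerm_mul_le (by positivity) (hNmul (J n) i ((le_max_left _ _).trans_lt h2) k
      ((le_max_right _ _).trans_lt h2))).trans ?_
    gcongr
  · obtain ⟨i, rfl⟩ := he γ
    refine Negligible.of_forall fun η hη => ?_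
    filter_upwards [hsmall (η / 2) (by positivity), hJ.eventually_gt_atTop i, hev]
      with n h1 h2 h3
    have h4 := card_blockPerm_fixed_le (n := n) (hNpos (J n)) (by positivity)
      (hNfix (J n) i h2 hγ)
    have h5 : 1 / ((J n : ℝ) + 1) * n ≤ η / 2 * n := by gcongr
    linarith [h3.1]
  · obtain ⟨g, hg⟩ := (conjugateReps_iff hω φ ψ).1 hconj
    set η := δ / (2 * (δ + 2 * S.card)) with hη
    have hη0 : 0 < η := by positivity
    have hηeq : (δ + 2 * S.card) * η = δ / 2 := by
      rw [hη]
      field_simp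
    have hgS : ∀ᶠ n in (ω : Filter ℕ), ∀ s ∈ S,
        ((Finset.univ.filter fun x => φ s n (g n x) ≠ g n (ψ s n x)).card : ℝ) ≤ η * n :=
      (Filter.eventually_all_finset S).2 fun s _ => (hg s).eventually hη0
    obtain ⟨n, hgn, ⟨_, hbadn⟩, hηn, hn⟩ :=
      (hgS.and (hev.and ((hsmall η hη0).and (hlarge 1)))).exists
    have hn0 : (0 : ℝ) < n := by exact_mod_cast hn
    set K := N (J n) with hK
    set X := (Finset.univ.filter (bad K n))ᶜ with hX
    have hXmem : ∀ v ∈ X, ¬ bad K n v := fun v hv => by simpa [hX] using hv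
    have hXc : (Xᶜ.card : ℝ) ≤ η * n := by
      rw [hX, compl_compl]
      exact hbadn.trans (by gcongr)
    have hXcard : (X.card : ℝ) = n - Xᶜ.card := by
      have := Finset.card_add_card_compl X
      rw [Fintype.card_fin] at this
      have : (X.card : ℝ) + Xᶜ.card = n := by exact_mod_cast this
      linarith
    have hmain := mul_card_le_of_partition hsym hexp (a := fun γ => φ γ n) (K := K) X
      (fun v hv => by
        by_contra h
        exact hXmem v hv (Or.inl (Or.inl h)))
      (fun v hv s hs => by
        by_contra h
        exact hXmem v hv (Or.inl (Or.inr ⟨s, hs, h⟩)))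
      (fun v hv => by
        by_contra h
        exact hXmem v hv (Or.inr (Or.inl h)))
      (fun v hv s hs γ hγ => by
        by_contra h
        exact hXmem v hv (Or.inr (Or.inr ⟨s, hs, γ, hγ, h⟩)))
      (fun v => blockLabel n K ((g n).symm v))
      (fun i => by
        refine le_trans ?_ (card_blockLabel_le (n := n) (hNpos (J n)) i)
        exact Finset.card_le_card_of_injOn (g n).symm (fun v hv => by simpa using hv)
          (g n).symm.injective.injOn)
    have hcross : ∀ s ∈ S, ((Finset.univ.filter fun v => blockLabel n K ((g n).symm (φ s n v)) ≠
        blockLabel n K ((g n).symm v)).card + Xᶜ.card : ℝ) ≤ 2 * η * n := by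
      intro s hs
      have : ((Finset.univ.filter fun v => blockLabel n K ((g n).symm (φ s n v)) ≠
          blockLabel n K ((g n).symm v)).card : ℝ) ≤ η * n := by
        refine le_trans (Nat.cast_le.2 ?_) (hgn s hs)
        refine Finset.card_le_card_of_injOn (g n).symm (fun v hv => ?_)
          (g n).symm.injective.injOn
        have hv := (Finset.mem_filter.1 (Finset.mem_coe.1 hv)).2
        refine Finset.mem_coe.2 (Finset.mem_filter.2 ⟨Finset.mem_univ _, fun h => hv ?_⟩)
        rw [Equiv.apply_symm_apply] at h
        rw [h, Equiv.symm_apply_apply]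
        exact blockLabel_blockPerm _ _
      linarith
    have hfin := hmain.trans (Finset.sum_le_card_nsmul S _ _ hcross)
    rw [nsmul_eq_mul, hXcard] at hfin
    have h1 := mul_le_mul_of_nonneg_left hXc hδ.le
    have h2 : (δ + 2 * S.card) * η * n = δ / 2 * n := by rw [hηeq]
    have h3 : 0 < δ * n := by positivity
    linarith

/-- A finitely generated (sofic) group `Γ` is amenable if and only if any
two faithful embeddings of `Γ` into the metric ultraproduct `Σ = (∏ₙ Sₙ)/H` are conjugate by
an element of `Σ`. -/
theorem amenable_iff_unique_sofic_representation {Γ : Type} [Group Γ] [DecidableEq Γ]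
    (ω : Ultrafilter ℕ) (hω : (ω : Filter ℕ) ≤ Filter.cofinite)
    (S : Finset Γ) (hsym : ∀ s ∈ S, s⁻¹ ∈ S)
    (hgen : Subgroup.closure (S : Set Γ) = ⊤)
    (hsofic : ∃ φ : Γ → ∀ n : ℕ, Equiv.Perm (Fin n), IsSoficRep ω (fun n => n) φ) :
    (∃ F : ℕ → Finset Γ, IsFolnerSeq S F) ↔
      (∀ φ ψ : Γ → ∀ n : ℕ, Equiv.Perm (Fin n),
        IsSoficRep ω (fun n => n) φ → IsSoficRep ω (fun n => n) ψ →
          ConjugateReps ω (fun n => n) φ ψ) := by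
  have : Countable Γ := countable_of_closure_eq_top S hgen
  constructor
  · rintro ⟨F, hF⟩ φ ψ hφ hψ
    exact conjugateReps_of_amenable hω hφ hψ fun E ε hε => hF.exists_invariant hgen E hε
  · intro huniq
    obtain ⟨φ, hφ⟩ := hsofic
    by_contra hF
    obtain ⟨δ, hδ, hexp⟩ := exists_expansion_of_not_folner S hsym hF
    obtain ⟨ψ, hψ, hnot⟩ := hφ.exists_not_conjugateReps hω hsym hδ hexp
    exact hnot (huniq φ ψ hφ hψ)
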